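/- arXiv:2112.08026 — 3 statements merged into one kernel-verified Lean document; each statement's English description precedes it below -/
import Mathlib

section
/- Let Ω ⊆ ℝ^d be open, let σ : Ω → (0,∞) be continuous with σ(x) > 0 for all x ∈ Ω, and let q, p : Ω → [1,∞) be measurable with ess sup q < ∞ and ess sup p < ∞. Let (φ_n)_{n∈ℕ} be a sequence of C^∞ vector fields φ_n : Ω → ℝ^m and let T : Ω → ℝ^{m×d} be measurable with ∫_Ω |T(x)|^{p(x)} σ(x) dx < ∞. If ∫_Ω |φ_n(x)|^{q(x)} σ(x) dx → 0 and ∫_Ω |∇φ_n(x) − T(x)|^{p(x)} σ(x) dx → 0 as n → ∞, then T = 0 Lebesgue-a.e. in Ω. -/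
open MeasureTheory Filter

/-- On a set where the weight is bounded below, the `L¹` norm is controlled by the weighted
variable exponent modular, up to an arbitrarily small multiple of the measure of the set. -/
theorem setLIntegral_enorm_le_modular {α E : Type*} [MeasurableSpace α] [NormedAddCommGroup E]
    {μ : Measure α} {Ω K : Set α} (hK : MeasurableSet K) (hKΩ : K ⊆ Ω) {σ q : α → ℝ} {c Q : ℝ}
    (hc : 0 < c) (hσ : ∀ x ∈ K, c ≤ σ x) (hq1 : ∀ x ∈ Ω, 1 ≤ q x) (hqQ : ∀ x ∈ Ω, q x ≤ Q)
    (f : α → E) {ε : ℝ} (hε : 0 < ε) (hε1 : ε ≤ 1) :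
    ∫⁻ x in K, ‖f x‖ₑ ∂μ ≤ ENNReal.ofReal ε * μ K + ENNReal.ofReal (ε ^ (1 - Q) / c) *
      ∫⁻ x in Ω, ENNReal.ofReal (‖f x‖ ^ q x * σ x) ∂μ := by
  have key : ∀ x ∈ K, ‖f x‖ₑ ≤ ENNReal.ofReal ε +
      ENNReal.ofReal (ε ^ (1 - Q) / c) * ENNReal.ofReal (‖f x‖ ^ q x * σ x) := by
    intro x hx
    have hσx : 0 < σ x := hc.trans_le (hσ x hx)
    rw [← ofReal_norm, ← ENNReal.ofReal_mul (by positivity),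
      ← ENNReal.ofReal_add hε.le (by positivity)]
    apply ENNReal.ofReal_le_ofReal
    rcases le_total ‖f x‖ ε with h | h
    · exact h.trans (le_add_of_nonneg_right (by positivity))
    · have hf : 0 < ‖f x‖ := hε.trans_le h
      have h1 : ‖f x‖ ≤ ε ^ (1 - q x) * ‖f x‖ ^ q x := by
        have : ‖f x‖ / ε ≤ (‖f x‖ / ε) ^ q x :=
          Real.self_le_rpow_of_one_le ((one_le_div hε).2 h) (hq1 x (hKΩ hx))
        rw [Real.div_rpow hf.le hε.le, div_le_iff₀ hε] at this
        rw [Real.rpow_sub hε, Real.rpow_one]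
        calc ‖f x‖ ≤ _ := this
          _ = _ := by ring
      have h2 : ε ^ (1 - q x) ≤ ε ^ (1 - Q) :=
        Real.rpow_le_rpow_of_exponent_ge hε hε1 (by linarith [hqQ x (hKΩ hx)])
      have h3 : 1 ≤ σ x / c := (one_le_div hc).2 (hσ x hx)
      calc ‖f x‖ ≤ ε ^ (1 - q x) * ‖f x‖ ^ q x := h1
        _ ≤ ε ^ (1 - Q) * ‖f x‖ ^ q x := by gcongr
        _ ≤ ε ^ (1 - Q) * ‖f x‖ ^ q x * (σ x / c) :=
          le_mul_of_one_le_right (by positivity) h3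
        _ = ε ^ (1 - Q) / c * (‖f x‖ ^ q x * σ x) := by ring
        _ ≤ _ := le_add_of_nonneg_left hε.le
  calc ∫⁻ x in K, ‖f x‖ₑ ∂μ
      ≤ ∫⁻ x in K, (ENNReal.ofReal ε + ENNReal.ofReal (ε ^ (1 - Q) / c) *
          ENNReal.ofReal (‖f x‖ ^ q x * σ x)) ∂μ := setLIntegral_mono' hK key
    _ = ENNReal.ofReal ε * μ K + ENNReal.ofReal (ε ^ (1 - Q) / c) *
          ∫⁻ x in K, ENNReal.ofReal (‖f x‖ ^ q x * σ x) ∂μ := by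
        rw [lintegral_add_left measurable_const, setLIntegral_const,
          lintegral_const_mul' _ _ ENNReal.ofReal_ne_top]
    _ ≤ _ := by gcongr

/-- Convergence to zero in the weighted modular implies convergence to zero in `L¹` on sets of
finite measure where the weight is bounded below. -/
theorem tendsto_setLIntegral_enorm_of_modular {α E : Type*} [MeasurableSpace α]
    [NormedAddCommGroup E] {μ : Measure α} {Ω K : Set α} (hK : MeasurableSet K) (hKΩ : K ⊆ Ω)
    (hμK : μ K ≠ ⊤) {σ q : α → ℝ} {c Q : ℝ} (hc : 0 < c) (hσ : ∀ x ∈ K, c ≤ σ x)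
    (hq1 : ∀ x ∈ Ω, 1 ≤ q x) (hqQ : ∀ x ∈ Ω, q x ≤ Q) (f : ℕ → α → E)
    (hf : Tendsto (fun n => ∫⁻ x in Ω, ENNReal.ofReal (‖f n x‖ ^ q x * σ x) ∂μ) atTop (nhds 0)) :
    Tendsto (fun n => ∫⁻ x in K, ‖f n x‖ₑ ∂μ) atTop (nhds 0) := by
  have hlim : ∀ ε : ℝ, 0 < ε → ε ≤ 1 →
      limsup (fun n => ∫⁻ x in K, ‖f n x‖ₑ ∂μ) atTop ≤ ENNReal.ofReal ε * μ K := by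
    intro ε hε hε1
    have h : Tendsto (fun n => ENNReal.ofReal ε * μ K + ENNReal.ofReal (ε ^ (1 - Q) / c) *
        ∫⁻ x in Ω, ENNReal.ofReal (‖f n x‖ ^ q x * σ x) ∂μ) atTop
        (nhds (ENNReal.ofReal ε * μ K)) := by
      simpa using (ENNReal.Tendsto.const_mul hf (Or.inr ENNReal.ofReal_ne_top)).const_add
        (ENNReal.ofReal ε * μ K)
    rw [← h.limsup_eq]
    exact limsup_le_limsup (Eventually.of_forall fun n =>
      setLIntegral_enorm_le_modular hK hKΩ hc hσ hq1 hqQ (f n) hε hε1)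
  have h0 : Tendsto (fun ε : ℝ => ENNReal.ofReal ε * μ K) (nhdsWithin 0 (Set.Ioi 0)) (nhds 0) := by
    have : Tendsto (fun ε : ℝ => ENNReal.ofReal ε) (nhdsWithin 0 (Set.Ioi 0)) (nhds 0) := by
      simpa using (ENNReal.tendsto_ofReal (tendsto_id (x := nhds (0 : ℝ)))).mono_left
        nhdsWithin_le_nhds
    simpa using ENNReal.Tendsto.mul_const this (Or.inr hμK)
  refine tendsto_of_le_liminf_of_limsup_le zero_le ?_
  refine ge_of_tendsto h0 ?_
  filter_upwards [Ioc_mem_nhdsGT (zero_lt_one' ℝ)] with ε hε using hlim ε hε.1 hε.2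

/-- Pairing with a bounded function supported in `K` is continuous for `L¹` convergence on `K`. -/
theorem tendsto_integral_mul_of_setLIntegral_enorm {α : Type*} [MeasurableSpace α]
    {μ : Measure α} {K : Set α} (hK : MeasurableSet K) {g : α → ℝ} {C : ℝ}
    (hgC : ∀ x, ‖g x‖ ≤ C) (hg : ∀ x ∉ K, g x = 0) {f : ℕ → α → ℝ}
    (hf : Tendsto (fun n => ∫⁻ x in K, ‖f n x‖ₑ ∂μ) atTop (nhds 0)) :
    Tendsto (fun n => ∫ x, g x * f n x ∂μ) atTop (nhds 0) := by
  rw [tendsto_zero_iff_enorm_tendsto_zero]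
  have hC : Tendsto (fun n => ENNReal.ofReal C * ∫⁻ x in K, ‖f n x‖ₑ ∂μ) atTop (nhds 0) := by
    simpa using ENNReal.Tendsto.const_mul hf (Or.inr ENNReal.ofReal_ne_top)
  refine tendsto_of_tendsto_of_tendsto_of_le_of_le tendsto_const_nhds hC
    (fun _ => zero_le) fun n => ?_
  calc ‖∫ x, g x * f n x ∂μ‖ₑ ≤ ∫⁻ x, ‖g x * f n x‖ₑ ∂μ := enorm_integral_le_lintegral_enorm _
    _ ≤ ∫⁻ x, K.indicator (fun x => ENNReal.ofReal C * ‖f n x‖ₑ) x ∂μ := by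
        refine lintegral_mono fun x => ?_
        by_cases hx : x ∈ K
        · rw [Set.indicator_of_mem hx, enorm_mul, ← ofReal_norm (g x)]
          gcongr
          exact hgC x
        · simp [hg x hx]
    _ = _ := by
        rw [lintegral_indicator hK, lintegral_const_mul' _ _ ENNReal.ofReal_ne_top]

/-- Integration by parts against a test function supported in an open set where the other factor
is continuously differentiable. -/
theorem integrable_and_integral_mul_fderiv_of_contDiffOn {E : Type*} [NormedAddCommGroup E]
    [NormedSpace ℝ E] [FiniteDimensional ℝ E] [MeasurableSpace E] [BorelSpace E]
    {μ : Measure E} [μ.IsAddHaarMeasure] {Ω : Set E} (hΩ : IsOpen Ω) {u g : E → ℝ}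
    (hu : ContDiffOn ℝ 1 u Ω) (hg : ContDiff ℝ 1 g) (hgc : HasCompactSupport g)
    (hgΩ : tsupport g ⊆ Ω) (v : E) :
    Integrable (fun x => g x * fderiv ℝ u x v) μ ∧
      ∫ x, g x * fderiv ℝ u x v ∂μ = -∫ x, fderiv ℝ g x v * u x ∂μ := by
  have hg0 : ∀ x ∉ tsupport g, g =ᶠ[nhds x] 0 := fun x hx => notMem_tsupport_iff_eventuallyEq.1 hx
  have hua : ∀ x ∈ tsupport g, ContDiffAt ℝ 1 u x := fun x hx =>
    hu.contDiffAt (hΩ.mem_nhds (hgΩ hx))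
  have hgu : ContDiff ℝ 1 (fun x => g x * u x) := by
    refine contDiff_iff_contDiffAt.2 fun x => ?_
    by_cases hx : x ∈ tsupport g
    · exact hg.contDiffAt.mul (hua x hx)
    · refine (contDiffAt_const (c := (0 : ℝ))).congr_of_eventuallyEq ?_
      filter_upwards [hg0 x hx] with y hy
      simp [hy]
  have hguc : HasCompactSupport (fun x => g x * u x) := hgc.mul_right
  have hD : ∀ x, fderiv ℝ (fun x => g x * u x) x v =
      g x * fderiv ℝ u x v + fderiv ℝ g x v * u x := by
    intro x
    by_cases hx : x ∈ tsupport g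
    · rw [fderiv_fun_mul (hg.differentiable one_ne_zero x)
        ((hua x hx).differentiableAt one_ne_zero)]
      simp [mul_comm]
    · have h1 : (fun x => g x * u x) =ᶠ[nhds x] fun _ => 0 := by
        filter_upwards [hg0 x hx] with y hy
        simp [hy]
      rw [h1.fderiv_eq, (hg0 x hx).fderiv_eq, (hg0 x hx).eq_of_nhds]
      simp
  have hDint : Integrable (fun x => fderiv ℝ (fun x => g x * u x) x v) μ :=
    ((hgu.continuous_fderiv one_ne_zero).clm_apply continuous_const).integrable_of_hasCompactSupport
      (hguc.fderiv_apply ℝ v)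
  have hDg : Integrable (fun x => fderiv ℝ g x v * u x) μ := by
    refine Continuous.integrable_of_hasCompactSupport ?_ (hgc.fderiv_apply ℝ v).mul_right
    refine continuous_iff_continuousAt.2 fun x => ?_
    have hgx : Continuous (fun x => fderiv ℝ g x v) :=
      (hg.continuous_fderiv one_ne_zero).clm_apply continuous_const
    by_cases hx : x ∈ tsupport g
    · exact hgx.continuousAt.mul (hua x hx).continuousAt
    · refine (continuousAt_const (y := (0 : ℝ))).congr ?_
      filter_upwards [(hg0 x hx).fderiv (𝕜 := ℝ)] with y hy
      simp [hy]
  have hgD : Integrable (fun x => g x * fderiv ℝ u x v) μ := by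
    refine (hDint.sub hDg).congr (Eventually.of_forall fun x => ?_)
    simp [hD]
  refine ⟨hgD, ?_⟩
  have hzero : ∫ x, fderiv ℝ (fun x => g x * u x) x v ∂μ = 0 := by
    have := integral_mul_fderiv_eq_neg_fderiv_mul_of_integrable (μ := μ) (v := v)
      (f := fun _ => (1 : ℝ)) (g := fun x => g x * u x) (by simp) (by simpa using hDint)
      (by simpa using hgu.continuous.integrable_of_hasCompactSupport hguc)
      (fun x _ => differentiableAt_const _) (fun x _ => hgu.differentiable one_ne_zero x)
    simpa using this
  simp_rw [hD] at hzero
  rw [integral_add hgD hDg] at hzero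
  linarith

/-- Remark 2.8 of the paper: every continuous positive
weight is admissible, i.e. the gradient is closable with respect to the
weighted modular convergences.  Here the Jacobian of `φₙ` is the matrix
`(i,j) ↦ ∂_j (φₙ)_i`. -/
theorem continuous_weight_admissible
    (d m : ℕ) (hd : 1 ≤ d) (Ω : Set (Fin d → ℝ)) (hΩ : IsOpen Ω)
    (σ : (Fin d → ℝ) → ℝ) (hσc : ContinuousOn σ Ω) (hσpos : ∀ x ∈ Ω, 0 < σ x)
    (q p : (Fin d → ℝ) → ℝ) (hqmeas : Measurable q) (hpmeas : Measurable p)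
    (hq1 : ∀ x ∈ Ω, 1 ≤ q x) (hp1 : ∀ x ∈ Ω, 1 ≤ p x)
    (Q P : ℝ) (hqQ : ∀ x ∈ Ω, q x ≤ Q) (hpP : ∀ x ∈ Ω, p x ≤ P)
    (φ : ℕ → (Fin d → ℝ) → (Fin m → ℝ)) (hφ : ∀ n, ContDiffOn ℝ (⊤ : ℕ∞) (φ n) Ω)
    (T : (Fin d → ℝ) → Fin m → Fin d → ℝ) (hT : Measurable T)
    (hTfin : (∫⁻ x in Ω, ENNReal.ofReal (‖T x‖ ^ p x * σ x)) < ⊤)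
    (h1 : Tendsto (fun n => ∫⁻ x in Ω, ENNReal.ofReal (‖φ n x‖ ^ q x * σ x))
      atTop (nhds 0))
    (h2 : Tendsto (fun n => ∫⁻ x in Ω, ENNReal.ofReal
        (‖(fun i j => fderiv ℝ (fun y => φ n y i) x (Pi.single j 1)) - T x‖ ^ p x
          * σ x))
      atTop (nhds 0)) :
    ∀ᵐ x ∂volume.restrict Ω, T x = 0 := by
  have hbelow : ∀ K ⊆ Ω, IsCompact K → ∃ c, 0 < c ∧ ∀ x ∈ K, c ≤ σ x := fun K hKΩ hK =>
    hK.exists_forall_le' (hσc.mono hKΩ) fun x hx => hσpos x (hKΩ hx)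
  have hTij : ∀ i j, ∀ᵐ x ∂volume, x ∈ Ω → T x i j = 0 := by
    intro i j
    have hTm : Measurable fun x => T x i j := (measurable_pi_apply j).comp
      ((measurable_pi_apply i).comp hT)
    have hentry : ∀ A : Fin m → Fin d → ℝ, ‖A i j‖ₑ ≤ ‖A‖ₑ := fun A =>
      enorm_le_iff_norm_le.2 ((norm_le_pi_norm (A i) j).trans (norm_le_pi_norm A i))
    have hTint : ∀ K ⊆ Ω, IsCompact K → IntegrableOn (fun x => T x i j) K := by
      intro K hKΩ hK
      obtain ⟨c, hc, hσK⟩ := hbelow K hKΩ hK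
      refine ⟨hTm.aestronglyMeasurable, ?_⟩
      calc ∫⁻ x in K, ‖T x i j‖ₑ ≤ ∫⁻ x in K, ‖T x‖ₑ := lintegral_mono fun x => hentry (T x)
        _ ≤ _ := setLIntegral_enorm_le_modular hK.measurableSet hKΩ hc hσK hp1 hpP T one_pos le_rfl
        _ < ⊤ := ENNReal.add_lt_top.2 ⟨ENNReal.mul_lt_top ENNReal.ofReal_lt_top hK.measure_lt_top,
          ENNReal.mul_lt_top ENNReal.ofReal_lt_top hTfin⟩
    refine hΩ.ae_eq_zero_of_integral_contDiff_smul_eq_zero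
      ((locallyIntegrableOn_iff hΩ.isLocallyClosed).2 hTint) fun g hg hgc hgΩ => ?_
    have hg1 : ContDiff ℝ 1 g := hg.of_le (by exact_mod_cast le_top)
    have hgK : ∀ x ∉ tsupport g, g x = 0 := fun x hx => image_eq_zero_of_notMem_tsupport hx
    have hK : IsCompact (tsupport g) := hgc
    have hKm := hK.measurableSet
    obtain ⟨c, hc, hσK⟩ := hbelow _ hgΩ hK
    obtain ⟨C, hC⟩ := hgc.exists_bound_of_continuous hg1.continuous
    let v : Fin d → ℝ := Pi.single j 1
    have hg' : Continuous fun x => fderiv ℝ g x v :=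
      (hg1.continuous_fderiv one_ne_zero).clm_apply continuous_const
    obtain ⟨C', hC'⟩ := (hgc.fderiv_apply ℝ v).exists_bound_of_continuous hg'
    have hg'K : ∀ x ∉ tsupport g, fderiv ℝ g x v = 0 := fun x hx => by
      rw [(notMem_tsupport_iff_eventuallyEq.1 hx).fderiv_eq]
      simp
    have lim1 := tendsto_integral_mul_of_setLIntegral_enorm (μ := volume) hKm hC' hg'K
      (f := fun n x => φ n x i)
      (tendsto_of_tendsto_of_tendsto_of_le_of_le tendsto_const_nhds
        (tendsto_setLIntegral_enorm_of_modular hKm hgΩ hK.measure_ne_top hc hσK hq1 hqQ φ h1)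
        (fun _ => zero_le) fun n => lintegral_mono fun x =>
          enorm_le_iff_norm_le.2 (norm_le_pi_norm (φ n x) i))
    have lim2 := tendsto_integral_mul_of_setLIntegral_enorm (μ := volume) hKm hC hgK
      (f := fun n x => fderiv ℝ (fun y => φ n y i) x v - T x i j)
      (tendsto_of_tendsto_of_tendsto_of_le_of_le tendsto_const_nhds
        (tendsto_setLIntegral_enorm_of_modular hKm hgΩ hK.measure_ne_top hc hσK hp1 hpP _ h2)
        (fun _ => zero_le) fun n => lintegral_mono fun x => hentry
          ((fun i j => fderiv ℝ (fun y => φ n y i) x (Pi.single j 1)) - T x))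
    have hgT : Integrable fun x => g x * T x i j := by
      have h : IntegrableOn (fun x => g x * T x i j) (tsupport g) :=
        (hTint _ hgΩ hK).continuousOn_mul hg1.continuous.continuousOn hK
      refine (integrableOn_iff_integrable_of_support_subset fun x hx => ?_).1 h
      by_contra hxK
      exact hx (by simp [hgK x hxK])
    have hsum : ∀ n, (∫ x, fderiv ℝ g x v * φ n x i) +
        ∫ x, g x * (fderiv ℝ (fun y => φ n y i) x v - T x i j) = -∫ x, g x * T x i j := by
      intro n
      have hφi : ContDiffOn ℝ 1 (fun y => φ n y i) Ω :=
        (contDiffOn_pi.1 (hφ n) i).of_le (by exact_mod_cast le_top)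
      obtain ⟨hint, hparts⟩ := integrable_and_integral_mul_fderiv_of_contDiffOn (μ := volume)
        hΩ hφi hg1 hgc hgΩ v
      simp_rw [mul_sub]
      rw [integral_sub hint hgT, hparts]
      ring
    have hlim := lim1.add lim2
    simp_rw [hsum] at hlim
    simpa using tendsto_nhds_unique tendsto_const_nhds hlim
  rw [ae_restrict_iff' hΩ.measurableSet]
  filter_upwards [ae_all_iff.2 fun i => ae_all_iff.2 (hTij i)] with x hx hxΩ
  ext i j
  exact hx i j hxΩ
end

section
/- Let d ≥ 2, let Ω ⊆ ℝ^d be a bounded domain, and let p : Ω → ℝ be continuous with 2d/(d+2) ≤ p⁻ := inf_{x∈Ω} p(x) and p⁺ := sup_{x∈Ω} p(x) < ∞. Let Ω' be an open set with compact closure contained in Ω. Then there exists a constant c = c(p, Ω') > 0 such that for every vector field u ∈ C^∞(Ω; ℝ^d) with (∫_Ω |u|^{p⁻} dx)^{1/p⁻} < ∞ and ‖Du‖_{L^{p(·)}(Ω)} < ∞ one has ‖u‖_{L^{p(·)}(Ω')} ≤ c ( (∫_Ω |u|^{p⁻} dx)^{1/p⁻} + ‖Du‖_{L^{p(·)}(Ω)}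 ). -/
open MeasureTheory

/-- The Luxemburg norm `‖f‖_{L^{p(·)}(G)} = inf {λ > 0 | ∫_G (f/λ)^{p(x)} dx ≤ 1}`
of a (nonnegative) function `f` over a measurable set `G`. -/
noncomputable def luxNorm (d : ℕ) (G : Set (Fin d → ℝ))
    (p f : (Fin d → ℝ) → ℝ) : ℝ :=
  sInf {lam : ℝ | 0 < lam ∧ (∫⁻ x in G, ENNReal.ofReal ((f x / lam) ^ p x)) ≤ 1}

/-- The symmetric gradient `Du = (∇u + ∇uᵀ)/2` of a vector field `u`, as a
matrix-valued function. -/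
noncomputable def symGrad (d : ℕ) (u : (Fin d → ℝ) → (Fin d → ℝ))
    (x : Fin d → ℝ) : Fin d → Fin d → ℝ :=
  fun i j =>
    (fderiv ℝ (fun y => u y i) x (Pi.single j 1) +
      fderiv ℝ (fun y => u y j) x (Pi.single i 1)) / 2

open scoped ENNReal

theorem lintegral_rpow_le_of_measure_univ_le_one {α : Type*} [MeasurableSpace α] {μ : Measure α}
    (hμ : μ Set.univ ≤ 1) {f : α → ℝ≥0∞} (hf : AEMeasurable f μ) {q : ℝ} (hq : 1 ≤ q) :
    (∫⁻ a, f a ∂μ) ^ q ≤ ∫⁻ a, f a ^ q ∂μ := by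
  have hq0 : 0 < q := one_pos.trans_le hq
  have h := eLpNorm'_le_eLpNorm'_mul_rpow_measure_univ one_pos hq hf.aestronglyMeasurable
  simp only [eLpNorm'_eq_lintegral_enorm, enorm_eq_self, ENNReal.rpow_one, div_one] at h
  have h1 : μ Set.univ ^ (1 - 1 / q) ≤ 1 :=
    ENNReal.rpow_le_one hμ (sub_nonneg.2 ((div_le_one hq0).2 hq))
  have h2 := h.trans (mul_le_of_le_one_right' h1)
  calc _ ≤ ((∫⁻ a, f a ^ q ∂μ) ^ (1 / q)) ^ q := ENNReal.rpow_le_rpow h2 hq0.le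
    _ = _ := by rw [← ENNReal.rpow_mul, one_div_mul_cancel hq0.ne', ENNReal.rpow_one]

theorem lintegral_comp_add_smul {d : ℕ} (F : (Fin d → ℝ) → ℝ≥0∞) (hF : Measurable F)
    (x : Fin d → ℝ) {s : ℝ} (hs : 0 < s) :
    ∫⁻ w, F (x + s • w) = ENNReal.ofReal (s⁻¹ ^ d) * ∫⁻ y, F y := by
  have h1 : Measurable fun w : Fin d → ℝ => s • w := measurable_const_smul s
  have hF' : Measurable fun y => F (x + y) := hF.comp (measurable_const_add x)
  rw [← lintegral_map (f := fun y => F (x + y)) hF' h1, Measure.map_addHaar_smul _ hs.ne',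
    lintegral_smul_measure, lintegral_add_left_eq_self, smul_eq_mul]
  simp [abs_of_pos hs]

theorem lintegral_inv_sqrt_lt_top :
    ∫⁻ s in Set.Ioo (0 : ℝ) 1, ENNReal.ofReal (s ^ (-(1 / 2) : ℝ)) < ⊤ := by
  have h := (intervalIntegral.intervalIntegrable_rpow' (a := 0) (b := 1)
    (r := (-(1 / 2) : ℝ)) (by norm_num)).1
  exact (h.mono_set Set.Ioo_subset_Ioc_self).lintegral_lt_top

theorem add_rpow_le_two_rpow_mul (a b : ℝ≥0∞) {q : ℝ} (hq : 0 ≤ q) :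
    (a + b) ^ q ≤ 2 ^ q * (a ^ q + b ^ q) := by
  calc (a + b) ^ q ≤ (2 * max a b) ^ q := by
        gcongr
        rw [two_mul]
        exact add_le_add (le_max_left _ _) (le_max_right _ _)
    _ = 2 ^ q * (max a b) ^ q := ENNReal.mul_rpow_of_nonneg _ _ hq
    _ ≤ _ := by
        gcongr
        rcases max_choice a b with h | h <;> rw [h] <;> simp

theorem rpow_le_one_add_rpow (a : ℝ≥0∞) {q t : ℝ} (hq : 0 ≤ q) (ht : q ≤ t) :
    a ^ q ≤ 1 + a ^ t := by
  rcases le_total a 1 with h | h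
  · exact (ENNReal.rpow_le_one h hq).trans le_self_add
  · exact (ENNReal.rpow_le_rpow_of_exponent_le h ht).trans le_add_self

theorem lintegral_ball_rpow_le {d : ℕ} (hd : 0 < d) {P : (Fin d → ℝ) → ℝ} (hP : Measurable P)
    (hP1 : ∀ x, 1 ≤ P x) {g : (Fin d → ℝ) → ℝ≥0∞} (hg : Measurable g)
    (hg1 : ∫⁻ x, g x ^ P x ≤ 1) {r : ℝ}
    (hr : volume (Metric.ball (0 : Fin d → ℝ) r) ≤ 1) {x : Fin d → ℝ}
    (hx : ∀ y ∈ Metric.ball x r, |P y - P x| ≤ 1 / (2 * d)) {s : ℝ} (hs : s ∈ Set.Ioo (0 : ℝ) 1) :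
    (∫⁻ w in Metric.ball 0 r, g (x + s • w)) ^ P x ≤
      2 * ENNReal.ofReal (s ^ (-(1 / 2) : ℝ)) *
        (1 + ∫⁻ w in Metric.ball 0 r, g (x + s • w) ^ P (x + s • w)) := by
  obtain ⟨hs0, hs1⟩ := hs
  have hd' : (0 : ℝ) < d := by exact_mod_cast hd
  set ε : ℝ := 1 / (2 * d) with hε
  have hε0 : 0 < ε := by positivity
  have hε1 : ε ≤ 1 := by
    rw [hε, div_le_one (by positivity)]
    have : (1 : ℝ) ≤ d := by exact_mod_cast hd
    linarith
  have hmap : Measurable fun w : Fin d → ℝ => x + s • w := by fun_prop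
  set q : ℝ := max 1 (P x - ε) with hq
  have hq1 : 1 ≤ q := le_max_left _ _
  have hPq : P x / q ≤ 1 + ε := by
    rw [div_le_iff₀ (by linarith)]
    have : P x - ε ≤ q := le_max_right _ _
    nlinarith
  have hmem : ∀ w ∈ Metric.ball (0 : Fin d → ℝ) r, q ≤ P (x + s • w) := by
    intro w hw
    have : x + s • w ∈ Metric.ball x r := by
      rw [mem_ball_zero_iff] at hw
      rw [mem_ball_iff_norm, add_sub_cancel_left, norm_smul, Real.norm_of_nonneg hs0.le]
      nlinarith [norm_nonneg w]
    have h := abs_le.1 (hx _ this)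
    exact max_le (hP1 _) (by linarith [h.1])
  set I := ∫⁻ w in Metric.ball 0 r, g (x + s • w) ^ P (x + s • w) with hI
  have hAq : (∫⁻ w in Metric.ball 0 r, g (x + s • w)) ^ q ≤ 1 + I := by
    calc _ ≤ ∫⁻ w in Metric.ball 0 r, g (x + s • w) ^ q :=
          lintegral_rpow_le_of_measure_univ_le_one (by simpa using hr)
            (hg.comp hmap).aemeasurable hq1
      _ ≤ ∫⁻ w in Metric.ball 0 r, (1 + g (x + s • w) ^ P (x + s • w)) :=
          setLIntegral_mono' measurableSet_ball fun w hw =>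
            rpow_le_one_add_rpow _ (by linarith) (hmem w hw)
      _ = volume (Metric.ball (0 : Fin d → ℝ) r) + I := by
          rw [lintegral_add_left measurable_const]
          simp [hI]
      _ ≤ 1 + I := by gcongr
  have hIs : 1 + I ≤ 2 * ENNReal.ofReal (s⁻¹ ^ d) := by
    have h1 : I ≤ ENNReal.ofReal (s⁻¹ ^ d) := by
      calc I ≤ ∫⁻ w, g (x + s • w) ^ P (x + s • w) := setLIntegral_le_lintegral _ _
        _ = ENNReal.ofReal (s⁻¹ ^ d) * ∫⁻ y, g y ^ P y :=
          lintegral_comp_add_smul (fun y => g y ^ P y) (hg.pow hP) x hs0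
        _ ≤ _ := mul_le_of_le_one_right' hg1
    have h2 : (1 : ℝ≥0∞) ≤ ENNReal.ofReal (s⁻¹ ^ d) := by
      rw [ENNReal.one_le_ofReal]
      exact one_le_pow₀ ((one_le_inv₀ hs0).2 hs1.le)
    rw [two_mul]
    exact add_le_add h2 h1
  have hfac : (2 * ENNReal.ofReal (s⁻¹ ^ d)) ^ ε ≤ 2 * ENNReal.ofReal (s ^ (-(1 / 2) : ℝ)) := by
    rw [ENNReal.mul_rpow_of_nonneg _ _ hε0.le]
    gcongr
    · calc (2 : ℝ≥0∞) ^ ε ≤ 2 ^ (1 : ℝ) :=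
            ENNReal.rpow_le_rpow_of_exponent_le (by norm_num) hε1
        _ = 2 := ENNReal.rpow_one _
    · rw [ENNReal.ofReal_rpow_of_nonneg (by positivity) hε0.le]
      apply le_of_eq
      congr 1
      rw [inv_pow, ← Real.rpow_natCast, ← Real.rpow_neg hs0.le, ← Real.rpow_mul hs0.le]
      congr 1
      rw [hε]
      field_simp
  calc _ = ((∫⁻ w in Metric.ball 0 r, g (x + s • w)) ^ q) ^ (P x / q) := by
        rw [← ENNReal.rpow_mul, mul_div_cancel₀ _ (by linarith)]
    _ ≤ (1 + I) ^ (P x / q) := by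
        have := hP1 x
        gcongr
    _ ≤ (1 + I) ^ (ε + 1) :=
        ENNReal.rpow_le_rpow_of_exponent_le le_self_add (by linarith)
    _ = (1 + I) ^ ε * (1 + I) := by
        rw [ENNReal.rpow_add_of_nonneg _ _ hε0.le zero_le_one, ENNReal.rpow_one]
    _ ≤ _ := by
        gcongr
        exact (ENNReal.rpow_le_rpow hIs hε0.le).trans hfac

theorem lintegral_averaged_rpow_le {d : ℕ} (hd : 0 < d) {P : (Fin d → ℝ) → ℝ} (hP : Measurable P)
    (hP1 : ∀ x, 1 ≤ P x) {g : (Fin d → ℝ) → ℝ≥0∞} (hg : Measurable g)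
    (hg1 : ∫⁻ x, g x ^ P x ≤ 1) {r : ℝ}
    (hr : volume (Metric.ball (0 : Fin d → ℝ) r) ≤ 1) {S : Set (Fin d → ℝ)} (hS : MeasurableSet S)
    (hx : ∀ x ∈ S, ∀ y ∈ Metric.ball x r, |P y - P x| ≤ 1 / (2 * d)) :
    ∫⁻ x in S, (∫⁻ s in Set.Ioo (0 : ℝ) 1, ∫⁻ w in Metric.ball 0 r, g (x + s • w)) ^ P x ≤
      2 * (∫⁻ s in Set.Ioo (0 : ℝ) 1, ENNReal.ofReal (s ^ (-(1 / 2) : ℝ))) *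
        (volume S + 1) := by
  have hF : Measurable fun y => g y ^ P y := hg.pow hP
  have hmeas : Measurable fun z : (Fin d → ℝ) × ℝ =>
      ∫⁻ w in Metric.ball 0 r, g (z.1 + z.2 • w) ^ P (z.1 + z.2 • w) :=
    Measurable.lintegral_prod_right' (f := fun z : ((Fin d → ℝ) × ℝ) × (Fin d → ℝ) =>
      g (z.1.1 + z.1.2 • z.2) ^ P (z.1.1 + z.1.2 • z.2)) (hF.comp (by fun_prop))
  have hmeas' : Measurable fun z : (Fin d → ℝ) × ℝ =>
      ∫⁻ w in Metric.ball 0 r, g (z.1 + z.2 • w) :=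
    Measurable.lintegral_prod_right' (f := fun z : ((Fin d → ℝ) × ℝ) × (Fin d → ℝ) =>
      g (z.1.1 + z.1.2 • z.2)) (hg.comp (by fun_prop))
  have hw : Measurable fun s : ℝ => ENNReal.ofReal (s ^ (-(1 / 2) : ℝ)) := by fun_prop
  have hinner : ∀ s : ℝ, ∫⁻ x in S, ∫⁻ w in Metric.ball 0 r, g (x + s • w) ^ P (x + s • w) ≤ 1 := by
    intro s
    have hm : Measurable fun z : (Fin d → ℝ) × (Fin d → ℝ) =>
        g (z.1 + s • z.2) ^ P (z.1 + s • z.2) := hF.comp (by fun_prop)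
    rw [lintegral_lintegral_swap hm.aemeasurable]
    calc _ ≤ ∫⁻ w in Metric.ball (0 : Fin d → ℝ) r, 1 := by
          refine lintegral_mono fun w => ?_
          refine (setLIntegral_le_lintegral _ _).trans ?_
          rwa [lintegral_add_right_eq_self (fun y => g y ^ P y)]
      _ ≤ 1 := by simpa using hr
  calc _ ≤ ∫⁻ x in S, ∫⁻ s in Set.Ioo (0 : ℝ) 1, 2 * ENNReal.ofReal (s ^ (-(1 / 2) : ℝ)) *
        (1 + ∫⁻ w in Metric.ball 0 r, g (x + s • w) ^ P (x + s • w)) := by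
        refine setLIntegral_mono' hS fun x hxS => ?_
        refine (lintegral_rpow_le_of_measure_univ_le_one (by simp)
          (hmeas'.comp measurable_prodMk_left).aemeasurable (hP1 x)).trans ?_
        exact setLIntegral_mono' measurableSet_Ioo fun s hs =>
          lintegral_ball_rpow_le hd hP hP1 hg hg1 hr (hx x hxS) hs
    _ = ∫⁻ s in Set.Ioo (0 : ℝ) 1, ∫⁻ x in S, 2 * ENNReal.ofReal (s ^ (-(1 / 2) : ℝ)) *
        (1 + ∫⁻ w in Metric.ball 0 r, g (x + s • w) ^ P (x + s • w)) :=
        lintegral_lintegral_swap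
          ((((hw.comp measurable_snd).const_mul 2).mul (hmeas.const_add 1)).aemeasurable)
    _ ≤ ∫⁻ s in Set.Ioo (0 : ℝ) 1, 2 * ENNReal.ofReal (s ^ (-(1 / 2) : ℝ)) * (volume S + 1) := by
        refine lintegral_mono fun s => ?_
        have hm := hmeas.comp (measurable_prodMk_right (y := s))
        simp only [Function.comp_def] at hm
        simp only
        rw [lintegral_const_mul _ (hm.const_add 1), lintegral_add_left measurable_const]
        gcongr
        · simp
        · exact hinner s
    _ = _ := by
        rw [lintegral_mul_const _ (hw.const_mul 2), lintegral_const_mul _ hw]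

theorem sum_mul_fderiv_eq_sum_symGrad {d : ℕ} {u : (Fin d → ℝ) → (Fin d → ℝ)} (y w : Fin d → ℝ) :
    ∑ i, w i * fderiv ℝ (fun y => u y i) y w = ∑ i, ∑ j, w i * w j * symGrad d u y i j := by
  have h : ∀ i, fderiv ℝ (fun y => u y i) y w =
      ∑ j, w j * fderiv ℝ (fun y => u y i) y (Pi.single j 1) := by
    intro i
    conv_lhs => rw [pi_eq_sum_univ' w, map_sum]
    refine Finset.sum_congr rfl fun j _ => ?_
    rw [map_smul, smul_eq_mul]
  have h1 : ∑ i, w i * fderiv ℝ (fun y => u y i) y w =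
      ∑ i, ∑ j, w i * w j * fderiv ℝ (fun y => u y i) y (Pi.single j 1) := by
    simp only [h, Finset.mul_sum, mul_assoc]
  have h2 : ∑ i, w i * fderiv ℝ (fun y => u y i) y w =
      ∑ i, ∑ j, w i * w j * fderiv ℝ (fun y => u y j) y (Pi.single i 1) := by
    rw [h1, Finset.sum_comm]
    simp only [mul_comm]
  have h3 : ∑ i, ∑ j, w i * w j * symGrad d u y i j =
      (∑ i, ∑ j, w i * w j * fderiv ℝ (fun y => u y i) y (Pi.single j 1) +
       ∑ i, ∑ j, w i * w j * fderiv ℝ (fun y => u y j) y (Pi.single i 1)) / 2 := by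
    simp only [symGrad, ← Finset.sum_add_distrib, Finset.sum_div]
    refine Finset.sum_congr rfl fun i _ => Finset.sum_congr rfl fun j _ => ?_
    ring
  rw [h3, ← h1, ← h2]
  ring

theorem abs_sum_mul_symGrad_le {d : ℕ} {u : (Fin d → ℝ) → (Fin d → ℝ)} (y : Fin d → ℝ)
    {w : Fin d → ℝ} {r : ℝ} (hw : ‖w‖ ≤ r) :
    |∑ i, ∑ j, w i * w j * symGrad d u y i j| ≤ (d * r) ^ 2 * ‖symGrad d u y‖ := by
  have hr : 0 ≤ r := (norm_nonneg w).trans hw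
  have hij : ∀ i j, |w i * w j * symGrad d u y i j| ≤ r ^ 2 * ‖symGrad d u y‖ := by
    intro i j
    rw [abs_mul, abs_mul, pow_two]
    have h1 : |w i| ≤ r := (norm_le_pi_norm w i).trans hw
    have h2 : |w j| ≤ r := (norm_le_pi_norm w j).trans hw
    have h3 : |symGrad d u y i j| ≤ ‖symGrad d u y‖ :=
      (norm_le_pi_norm (symGrad d u y i) j).trans (norm_le_pi_norm (symGrad d u y) i)
    gcongr
  calc _ ≤ ∑ i : Fin d, ∑ j : Fin d, r ^ 2 * ‖symGrad d u y‖ :=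
        (Finset.abs_sum_le_sum_abs _ _).trans (Finset.sum_le_sum fun i _ =>
          (Finset.abs_sum_le_sum_abs _ _).trans (Finset.sum_le_sum fun j _ => hij i j))
    _ = _ := by
        simp only [Finset.sum_const, Finset.card_univ, Fintype.card_fin, nsmul_eq_mul]
        ring

theorem enorm_sum_mul_le {d : ℕ} {Ω : Set (Fin d → ℝ)} (hΩ : IsOpen Ω)
    {u : (Fin d → ℝ) → (Fin d → ℝ)} (hu : ContDiffOn ℝ 1 u Ω) {x : Fin d → ℝ} {r : ℝ}
    (hx : Metric.ball x r ⊆ Ω) {w : Fin d → ℝ} (hw : w ∈ Metric.ball 0 r) :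
    ‖∑ i, w i * u x i‖ₑ ≤ ENNReal.ofReal (d * r) * ‖u (x + w)‖ₑ +
      ENNReal.ofReal ((d * r) ^ 2) * ∫⁻ s in Set.Ioo (0 : ℝ) 1, ‖symGrad d u (x + s • w)‖ₑ := by
  rw [mem_ball_zero_iff] at hw
  have hr : 0 ≤ r := (norm_nonneg w).trans hw.le
  have hmem : ∀ s ∈ Set.Icc (0 : ℝ) 1, x + s • w ∈ Ω := by
    intro s hs
    apply hx
    rw [mem_ball_iff_norm, add_sub_cancel_left, norm_smul, Real.norm_of_nonneg hs.1]
    nlinarith [norm_nonneg w, hs.2]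
  have hui : ∀ i, ContDiffOn ℝ 1 (fun y => u y i) Ω := fun i => contDiffOn_pi.1 hu i
  have hφ : ContDiffOn ℝ 1 (fun s : ℝ => ∑ i, w i * u (x + s • w) i) (Set.Icc 0 1) := by
    refine ContDiffOn.sum fun i _ => contDiffOn_const.mul ?_
    exact (hui i).comp (f := fun s : ℝ => x + s • w) (by fun_prop) hmem
  have hderiv : ∀ s ∈ Set.Icc (0 : ℝ) 1, HasDerivAt (fun s : ℝ => ∑ i, w i * u (x + s • w) i)
      (∑ i, w i * fderiv ℝ (fun y => u y i) (x + s • w) w) s := by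
    intro s hs
    refine HasDerivAt.fun_sum fun i _ => HasDerivAt.const_mul _ ?_
    have h1 : HasDerivAt (fun s : ℝ => x + s • w) w s := by
      simpa using ((hasDerivAt_id s).smul_const w).const_add x
    have h2 := (((hui i).contDiffAt (hΩ.mem_nhds (hmem s hs))).differentiableAt
      one_ne_zero).hasFDerivAt
    exact h2.comp_hasDerivAt s h1
  have hftc := enorm_sub_le_lintegral_deriv_of_contDiffOn_Icc hφ zero_le_one
  rw [← restrict_Ioo_eq_restrict_Icc] at hftc
  simp only [one_smul, zero_smul, add_zero] at hftc
  have hint : ∫⁻ s in Set.Ioo (0 : ℝ) 1, ‖deriv (fun s : ℝ => ∑ i, w i * u (x + s • w) i) s‖ₑ ≤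
      ENNReal.ofReal ((d * r) ^ 2) * ∫⁻ s in Set.Ioo (0 : ℝ) 1, ‖symGrad d u (x + s • w)‖ₑ := by
    rw [← lintegral_const_mul' _ _ ENNReal.ofReal_ne_top]
    refine setLIntegral_mono' measurableSet_Ioo fun s hs => ?_
    rw [(hderiv s (Set.Ioo_subset_Icc_self hs)).deriv, sum_mul_fderiv_eq_sum_symGrad,
      ← ofReal_norm, ← ofReal_norm, ← ENNReal.ofReal_mul (by positivity)]
    exact ENNReal.ofReal_le_ofReal (abs_sum_mul_symGrad_le _ hw.le)
  have hend : ‖∑ i, w i * u (x + w) i‖ₑ ≤ ENNReal.ofReal (d * r) * ‖u (x + w)‖ₑ := by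
    rw [← ofReal_norm, ← ofReal_norm, ← ENNReal.ofReal_mul (by positivity)]
    refine ENNReal.ofReal_le_ofReal ?_
    calc _ ≤ ∑ i : Fin d, r * ‖u (x + w)‖ := by
          refine norm_sum_le_of_le _ fun i _ => ?_
          rw [norm_mul]
          have h1 := (norm_le_pi_norm w i).trans hw.le
          have h2 := norm_le_pi_norm (u (x + w)) i
          gcongr
      _ = _ := by simp [mul_assoc]
  calc ‖∑ i, w i * u x i‖ₑ = ‖∑ i, w i * u (x + w) i -
        (∑ i, w i * u (x + w) i - ∑ i, w i * u x i)‖ₑ := by rw [sub_sub_cancel]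
    _ ≤ ‖∑ i, w i * u (x + w) i‖ₑ + ‖∑ i, w i * u (x + w) i - ∑ i, w i * u x i‖ₑ :=
        enorm_sub_le
    _ ≤ _ := add_le_add hend (hftc.trans hint)

theorem exists_enorm_le_averages (d : ℕ) (hd : 0 < d) {r : ℝ} (hr : 0 < r) :
    ∃ C : ℝ≥0∞, C ≠ ⊤ ∧ ∀ {Ω : Set (Fin d → ℝ)} {u : (Fin d → ℝ) → (Fin d → ℝ)}
      {U G : (Fin d → ℝ) → ℝ≥0∞} {x : Fin d → ℝ}, IsOpen Ω → ContDiffOn ℝ 1 u Ω →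
      Measurable U → Measurable G → (∀ y ∈ Ω, U y = ‖u y‖ₑ) → (∀ y ∈ Ω, G y = ‖symGrad d u y‖ₑ) →
      Metric.ball x r ⊆ Ω →
      ‖u x‖ₑ ≤ C * ((∫⁻ w in Metric.ball 0 r, U (x + w)) +
        ∫⁻ s in Set.Ioo (0 : ℝ) 1, ∫⁻ w in Metric.ball 0 r, G (x + s • w)) := by
  set b : ℝ≥0∞ := ENNReal.ofReal (r / 2) * volume (Metric.ball (0 : Fin d → ℝ) (r / 2)) with hb
  have hb0 : b ≠ 0 := mul_ne_zero (by simpa using hr)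
    (Metric.measure_ball_pos _ _ (by positivity)).ne'
  have hbt : b ≠ ⊤ := ENNReal.mul_ne_top ENNReal.ofReal_ne_top measure_ball_lt_top.ne
  set A : ℝ≥0∞ := ENNReal.ofReal (d * r) + ENNReal.ofReal ((d * r) ^ 2) with hA
  refine ⟨b⁻¹ * (2 * A), ENNReal.mul_ne_top (ENNReal.inv_ne_top.2 hb0) (by finiteness), ?_⟩
  intro Ω u U G x hΩ hu hU hG hUu hGu hx
  set H : (Fin d → ℝ) → ℝ≥0∞ := fun w => A * (U (x + w) +
    ∫⁻ s in Set.Ioo (0 : ℝ) 1, G (x + s • w)) with hH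
  have hGm : Measurable fun z : (Fin d → ℝ) × ℝ => G (x + z.2 • z.1) := hG.comp (by fun_prop)
  have hUm : Measurable fun w => U (x + w) := hU.comp (by fun_prop)
  have hHm : Measurable H := (hUm.add hGm.lintegral_prod_right').const_mul A
  have hHw : ∀ w ∈ Metric.ball (0 : Fin d → ℝ) r, ‖∑ i, w i * u x i‖ₑ ≤ H w := by
    intro w hw
    refine (enorm_sum_mul_le hΩ hu hx hw).trans ?_
    rw [mem_ball_zero_iff] at hw
    have hmem : ∀ s ∈ Set.Icc (0 : ℝ) 1, x + s • w ∈ Ω := by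
      intro s hs
      apply hx
      rw [mem_ball_iff_norm, add_sub_cancel_left, norm_smul, Real.norm_of_nonneg hs.1]
      nlinarith [norm_nonneg w, hs.2]
    have h1 : ‖u (x + w)‖ₑ = U (x + w) := by
      rw [hUu]
      simpa using hmem 1 (by simp)
    have h2 : ∫⁻ s in Set.Ioo (0 : ℝ) 1, ‖symGrad d u (x + s • w)‖ₑ =
        ∫⁻ s in Set.Ioo (0 : ℝ) 1, G (x + s • w) :=
      setLIntegral_congr_fun measurableSet_Ioo fun s hs =>
        (hGu _ (hmem s (Set.Ioo_subset_Icc_self hs))).symm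
    rw [h1, h2, hH]
    simp only
    rw [mul_add]
    gcongr
    · exact le_self_add
    · exact le_add_self
  have hHint : ∫⁻ w in Metric.ball 0 r, H w = A * ((∫⁻ w in Metric.ball 0 r, U (x + w)) +
        ∫⁻ s in Set.Ioo (0 : ℝ) 1, ∫⁻ w in Metric.ball 0 r, G (x + s • w)) := by
    have hm : Measurable fun w => U (x + w) + ∫⁻ s in Set.Ioo (0 : ℝ) 1, G (x + s • w) :=
      hUm.add hGm.lintegral_prod_right'
    rw [hH, lintegral_const_mul _ hm, lintegral_add_left hUm,
      lintegral_lintegral_swap hGm.aemeasurable]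
  have hj : ∀ j, b * ‖u x j‖ₑ ≤ 2 * ∫⁻ w in Metric.ball 0 r, H w := by
    intro j
    set c : Fin d → ℝ := Pi.single j (r / 2) with hc
    have hcn : ‖c‖ = r / 2 := by
      rw [hc, Pi.norm_single, Real.norm_of_nonneg (by positivity)]
    have hz : ∀ z ∈ Metric.ball (0 : Fin d → ℝ) (r / 2),
        ENNReal.ofReal (r / 2) * ‖u x j‖ₑ ≤ H (z + c) + H z := by
      intro z hz
      rw [mem_ball_zero_iff] at hz
      have h1 : (r / 2) * u x j = ∑ i, (z + c) i * u x i - ∑ i, z i * u x i := by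
        simp [add_mul, Finset.sum_add_distrib, hc, Pi.single_apply]
      have h2 : z + c ∈ Metric.ball (0 : Fin d → ℝ) r := by
        rw [mem_ball_zero_iff]
        linarith [norm_add_le z c]
      have h3 : z ∈ Metric.ball (0 : Fin d → ℝ) r := by
        rw [mem_ball_zero_iff]
        linarith
      calc ENNReal.ofReal (r / 2) * ‖u x j‖ₑ = ‖(r / 2) * u x j‖ₑ := by
            rw [enorm_mul, Real.enorm_of_nonneg (r := r / 2) (by positivity)]
        _ ≤ _ := by
            rw [h1]
            exact enorm_sub_le.trans (add_le_add (hHw _ h2) (hHw _ h3))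
    calc b * ‖u x j‖ₑ = ∫⁻ z in Metric.ball (0 : Fin d → ℝ) (r / 2),
          ENNReal.ofReal (r / 2) * ‖u x j‖ₑ := by
          rw [setLIntegral_const, hb]
          ring
      _ ≤ ∫⁻ z in Metric.ball (0 : Fin d → ℝ) (r / 2), (H (z + c) + H z) :=
          setLIntegral_mono' measurableSet_ball hz
      _ = (∫⁻ z in Metric.ball (0 : Fin d → ℝ) (r / 2), H (z + c)) +
          ∫⁻ z in Metric.ball (0 : Fin d → ℝ) (r / 2), H z :=
          lintegral_add_right _ hHm
      _ ≤ (∫⁻ w in Metric.ball 0 r, H w) + ∫⁻ w in Metric.ball 0 r, H w := by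
          refine add_le_add ?_ (lintegral_mono_set (Metric.ball_subset_ball (by linarith)))
          rw [← lintegral_indicator measurableSet_ball, ← lintegral_indicator measurableSet_ball,
            ← lintegral_add_right_eq_self (fun w => (Metric.ball 0 r).indicator H w) c]
          refine lintegral_mono fun z => ?_
          by_cases hz : z ∈ Metric.ball (0 : Fin d → ℝ) (r / 2)
          · rw [Set.indicator_of_mem hz, Set.indicator_of_mem]
            rw [mem_ball_zero_iff] at hz ⊢
            linarith [norm_add_le z c]
          · rw [Set.indicator_of_notMem hz]
            exact zero_le
      _ = _ := (two_mul _).symm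
  have : Nonempty (Fin d) := ⟨⟨0, hd⟩⟩
  obtain ⟨j, -, hjmax⟩ := Finset.exists_mem_eq_sup Finset.univ Finset.univ_nonempty
    fun j => ‖u x j‖₊
  have hux : ‖u x‖ₑ = ‖u x j‖ₑ := by
    rw [enorm_eq_nnnorm, enorm_eq_nnnorm, Pi.nnnorm_def, hjmax]
  rw [hux, mul_assoc, mul_assoc, ← hHint, mul_comm b⁻¹, ← div_eq_mul_inv,
    ENNReal.le_div_iff_mul_le (Or.inl hb0) (Or.inl hbt), mul_comm]
  exact hj j

theorem continuousOn_symGrad {d : ℕ} {Ω : Set (Fin d → ℝ)} (hΩ : IsOpen Ω)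
    {u : (Fin d → ℝ) → (Fin d → ℝ)} (hu : ContDiffOn ℝ 1 u Ω) :
    ContinuousOn (symGrad d u) Ω := by
  have h : ∀ i (w : Fin d → ℝ), ContinuousOn (fun x => fderiv ℝ (fun y => u y i) x w) Ω :=
    fun i w => ((contDiffOn_pi.1 hu i).continuousOn_fderiv_of_isOpen hΩ le_rfl).clm_apply
      continuousOn_const
  exact continuousOn_pi.2 fun i => continuousOn_pi.2 fun j => ((h i _).add (h j _)).div_const 2

theorem ContinuousOn.measurable_indicator_of_isOpen {X Y : Type*} [TopologicalSpace X]
    [MeasurableSpace X] [OpensMeasurableSpace X] [TopologicalSpace Y] [MeasurableSpace Y]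
    [BorelSpace Y] [Zero Y] {f : X → Y} {s : Set X} (hs : IsOpen s) (hf : ContinuousOn f s) :
    Measurable (s.indicator f) := by
  classical
  rw [← Set.piecewise_eq_indicator]
  exact hf.measurable_piecewise continuous_zero.continuousOn hs.measurableSet

theorem exists_radius_oscillation_le {X : Type*} [PseudoMetricSpace X] [ProperSpace X]
    {K Ω : Set X} (hK : IsCompact K) (hΩ : IsOpen Ω) (hKΩ : K ⊆ Ω) {p : X → ℝ}
    (hp : ContinuousOn p Ω) {ε : ℝ} (hε : 0 < ε) :
    ∃ r > 0, ∀ x ∈ K, Metric.ball x r ⊆ Ω ∧ ∀ y ∈ Metric.ball x r, |p y - p x| ≤ ε := by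
  obtain ⟨δ, hδ, hδΩ⟩ := hK.exists_cthickening_subset_open hΩ hKΩ
  have huc := (hK.cthickening (r := δ)).uniformContinuousOn_of_continuous (hp.mono hδΩ)
  obtain ⟨η, hη, hpη⟩ := Metric.uniformContinuousOn_iff_le.1 huc ε hε
  refine ⟨min δ η, lt_min hδ hη, fun x hx => ?_⟩
  have hsub : Metric.ball x (min δ η) ⊆ Metric.cthickening δ K := fun y hy =>
    Metric.mem_cthickening_of_dist_le y x δ K hx
      ((Metric.mem_ball.1 hy).le.trans (min_le_left _ _))
  refine ⟨hsub.trans hδΩ, fun y hy => ?_⟩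
  exact hpη y (hsub hy) x (Metric.self_subset_cthickening K hx)
    ((Metric.mem_ball.1 hy).le.trans (min_le_right _ _))

theorem lintegral_enorm_div_le {α E : Type*} [MeasurableSpace α] [NormedAddCommGroup E]
    {μ : Measure α} {u : α → E} {q : ℝ} (hq : 1 ≤ q) {κ : ℝ≥0∞} (hκ0 : κ ≠ 0) (hκ : κ ≠ ⊤)
    (h : ∫⁻ x, ENNReal.ofReal (‖u x‖ ^ q) ∂μ ≤ κ ^ q) :
    ∫⁻ x, ‖u x‖ₑ / κ ∂μ ≤ μ Set.univ + 1 := by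
  have hq0 : 0 < q := one_pos.trans_le hq
  calc ∫⁻ x, ‖u x‖ₑ / κ ∂μ ≤ ∫⁻ x, (1 + ENNReal.ofReal (‖u x‖ ^ q) / κ ^ q) ∂μ := by
        refine lintegral_mono fun x => ?_
        have := rpow_le_one_add_rpow (‖u x‖ₑ / κ) zero_le_one hq
        rw [ENNReal.rpow_one, ENNReal.div_rpow_of_nonneg _ _ hq0.le, ← ofReal_norm,
          ENNReal.ofReal_rpow_of_nonneg (norm_nonneg _) hq0.le] at this
        rwa [← ofReal_norm]
    _ = μ Set.univ + (∫⁻ x, ENNReal.ofReal (‖u x‖ ^ q) ∂μ) / κ ^ q := by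
        have hne : (κ ^ q)⁻¹ ≠ ⊤ := by
          rw [ENNReal.inv_ne_top]
          exact (ENNReal.rpow_pos (pos_iff_ne_zero.2 hκ0) hκ).ne'
        simp only [div_eq_mul_inv]
        rw [lintegral_add_left measurable_const, lintegral_mul_const' _ _ hne]
        simp
    _ ≤ _ := by
        gcongr
        exact ENNReal.div_le_of_le_mul (by simpa using h)

theorem exists_modular_bound
    (d : ℕ) (hd : 2 ≤ d) (Ω Ω' : Set (Fin d → ℝ))
    (hΩo : IsOpen Ω) (hΩb : Bornology.IsBounded Ω)
    (hΩ'o : IsOpen Ω') (hΩ'cpt : IsCompact (closure Ω')) (hΩ'sub : closure Ω' ⊆ Ω)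
    (p : (Fin d → ℝ) → ℝ) (hpc : ContinuousOn p Ω)
    (pminus pplus : ℝ) (hpm : 1 ≤ pminus) (hbounds : ∀ x ∈ Ω, pminus ≤ p x ∧ p x ≤ pplus) :
    ∃ K : ℝ, 0 < K ∧ ∀ u : (Fin d → ℝ) → (Fin d → ℝ), ContDiffOn ℝ 1 u Ω →
      ∀ n > 0, ∀ lam > 0, (∫⁻ x in Ω, ENNReal.ofReal (‖u x‖ ^ pminus)) ≤
        ENNReal.ofReal (n ^ pminus) →
      (∫⁻ x in Ω, ENNReal.ofReal ((‖symGrad d u x‖ / lam) ^ p x)) ≤ 1 →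
      (∫⁻ x in Ω', ENNReal.ofReal ((‖u x‖ / (K * (n + lam))) ^ p x)) ≤ 1 := by
  classical
  have hΩ'Ω : Ω' ⊆ Ω := subset_closure.trans hΩ'sub
  have hvol : volume Ω ≠ ⊤ := hΩb.measure_lt_top.ne
  have hvol' : volume Ω' ≠ ⊤ := ((measure_mono hΩ'Ω).trans_lt hΩb.measure_lt_top).ne
  have hd0 : 0 < d := by omega
  set P : (Fin d → ℝ) → ℝ := Ω.piecewise p 1 with hPdef
  have hP : Measurable P := hpc.measurable_piecewise continuousOn_const hΩo.measurableSet
  have hPp : ∀ x ∈ Ω, P x = p x := fun x hx => Set.piecewise_eq_of_mem _ _ _ hx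
  have hP1 : ∀ x, 1 ≤ P x := by
    intro x
    by_cases hx : x ∈ Ω
    · rw [hPp x hx]
      exact hpm.trans (hbounds x hx).1
    · simp [hPdef, hx]
  set pp : ℝ := max pplus 1 with hpp
  have hPpp : ∀ x ∈ Ω, P x ≤ pp := fun x hx => by
    rw [hPp x hx]
    exact (hbounds x hx).2.trans (le_max_left _ _)
  have hpp0 : 0 ≤ pp := zero_le_one.trans (le_max_right _ _)
  obtain ⟨r₀, hr₀, hosc⟩ := exists_radius_oscillation_le hΩ'cpt hΩo hΩ'sub hpc
    (ε := 1 / (2 * d)) (by positivity)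
  set r : ℝ := min r₀ (1 / 2) with hr
  have hr0 : 0 < r := lt_min hr₀ (by norm_num)
  have hball : ∀ x ∈ Ω', Metric.ball x r ⊆ Ω := fun x hx =>
    (Metric.ball_subset_ball (min_le_left _ _)).trans (hosc x (subset_closure hx)).1
  have hoscP : ∀ x ∈ Ω', ∀ y ∈ Metric.ball x r, |P y - P x| ≤ 1 / (2 * d) := by
    intro x hx y hy
    rw [hPp x (hΩ'Ω hx), hPp y (hball x hx hy)]
    exact (hosc x (subset_closure hx)).2 y (Metric.ball_subset_ball (min_le_left _ _) hy)
  have hrvol : volume (Metric.ball (0 : Fin d → ℝ) r) ≤ 1 := by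
    rw [Real.volume_pi_ball _ hr0, ENNReal.ofReal_le_one]
    have : r ≤ 1 / 2 := min_le_right _ _
    exact pow_le_one₀ (by positivity) (by linarith)
  obtain ⟨C, hC, hpt⟩ := exists_enorm_le_averages d hd0 hr0
  set C' : ℝ≥0∞ := max C 1 with hC'
  have hC't : C' ≠ ⊤ := by simp [hC', hC]
  set a : ℝ≥0∞ := volume Ω + 1 with ha
  have ha1 : 1 ≤ a := le_add_self
  set J : ℝ≥0∞ := ∫⁻ s in Set.Ioo (0 : ℝ) 1, ENNReal.ofReal (s ^ (-(1 / 2) : ℝ)) with hJ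
  have hJt : J ≠ ⊤ := lintegral_inv_sqrt_lt_top.ne
  set M : ℝ≥0∞ := C' ^ pp * 2 ^ pp with hM
  set K₀ : ℝ≥0∞ := M * (a ^ pp * volume Ω' + 2 * J * (volume Ω' + 1)) with hK₀
  have hMt : M ≠ ⊤ := by finiteness
  have hK₀t : K₀ ≠ ⊤ := by finiteness
  set K : ℝ := max 1 K₀.toReal with hK
  have hK1 : 1 ≤ K := le_max_left _ _
  have hK0 : 0 < K := one_pos.trans_le hK1
  refine ⟨K, hK0, fun u hu n hn lam hlam hun hsym => ?_⟩
  set k : ℝ := n + lam with hk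
  have hk0 : 0 < k := by positivity
  set κ : ℝ≥0∞ := ENNReal.ofReal k with hκ
  have hκ0 : κ ≠ 0 := by simpa [hκ] using hk0
  have hκt : κ ≠ ⊤ := ENNReal.ofReal_ne_top
  have hκi : κ⁻¹ ≠ ⊤ := ENNReal.inv_ne_top.2 hκ0
  set U : (Fin d → ℝ) → ℝ≥0∞ := Ω.indicator fun y => ‖u y‖ₑ with hU
  set G : (Fin d → ℝ) → ℝ≥0∞ := Ω.indicator fun y => ‖symGrad d u y‖ₑ with hG
  have hUm : Measurable U := hu.continuousOn.enorm.measurable_indicator_of_isOpen hΩo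
  have hGm : Measurable G :=
    (continuousOn_symGrad hΩo hu).enorm.measurable_indicator_of_isOpen hΩo
  set g : (Fin d → ℝ) → ℝ≥0∞ := fun y => κ⁻¹ * G y with hg
  have hgm : Measurable g := hGm.const_mul _
  have hg1 : ∫⁻ x, g x ^ P x ≤ 1 := by
    refine le_trans ?_ hsym
    rw [← lintegral_indicator hΩo.measurableSet]
    refine lintegral_mono fun x => ?_
    by_cases hx : x ∈ Ω
    · have hp0 : 0 ≤ p x := by linarith [(hbounds x hx).1]
      simp only [Set.indicator_of_mem hx, hg, hG, hPp x hx]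
      rw [← ENNReal.ofReal_rpow_of_nonneg (by positivity) hp0, mul_comm, ← div_eq_mul_inv,
        ENNReal.ofReal_div_of_pos hlam, ofReal_norm]
      gcongr
      exact ENNReal.ofReal_le_ofReal (by linarith)
    · have : 0 < P x := one_pos.trans_le (hP1 x)
      simp [Set.indicator_of_notMem hx, hg, hG, this]
  have hUint : ∀ x, ∫⁻ w in Metric.ball 0 r, κ⁻¹ * U (x + w) ≤ a := by
    intro x
    calc _ ≤ ∫⁻ w, κ⁻¹ * U (x + w) := setLIntegral_le_lintegral _ _
      _ = ∫⁻ y, κ⁻¹ * U y := lintegral_add_left_eq_self (fun y => κ⁻¹ * U y) x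
      _ = ∫⁻ y in Ω, ‖u y‖ₑ / κ := by
        rw [← lintegral_indicator hΩo.measurableSet]
        congr 1
        ext y
        by_cases hy : y ∈ Ω <;> simp [hU, hy, div_eq_mul_inv, mul_comm]
      _ ≤ a := by
        rw [ha, ← Measure.restrict_apply_univ]
        refine lintegral_enorm_div_le hpm hκ0 hκt (hun.trans ?_)
        rw [hκ, ENNReal.ofReal_rpow_of_nonneg hk0.le (by linarith)]
        gcongr
        linarith
  set W : (Fin d → ℝ) → ℝ≥0∞ := fun x =>
    ∫⁻ s in Set.Ioo (0 : ℝ) 1, ∫⁻ w in Metric.ball 0 r, g (x + s • w) with hW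
  have hptw : ∀ x ∈ Ω', κ⁻¹ * ‖u x‖ₑ ≤ C' * (a + W x) := by
    intro x hx
    have h := hpt hΩo hu hUm hGm (fun y hy => Set.indicator_of_mem hy _)
      (fun y hy => Set.indicator_of_mem hy _) (hball x hx)
    calc κ⁻¹ * ‖u x‖ₑ ≤ κ⁻¹ * (C * ((∫⁻ w in Metric.ball 0 r, U (x + w)) +
          ∫⁻ s in Set.Ioo (0 : ℝ) 1, ∫⁻ w in Metric.ball 0 r, G (x + s • w))) := by gcongr
      _ = C * ((∫⁻ w in Metric.ball 0 r, κ⁻¹ * U (x + w)) + W x) := by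
        simp only [hW, hg, lintegral_const_mul' _ _ hκi]
        ring
      _ ≤ C' * (a + W x) := by
        gcongr
        · exact le_max_left _ _
        · exact hUint x
  have hpow : ∀ x ∈ Ω', (κ⁻¹ * ‖u x‖ₑ) ^ P x ≤ M * (a ^ pp + W x ^ P x) := by
    intro x hx
    have hPx0 : 0 ≤ P x := zero_le_one.trans (hP1 x)
    have hPx := hPpp x (hΩ'Ω hx)
    calc _ ≤ (C' * (a + W x)) ^ P x := ENNReal.rpow_le_rpow (hptw x hx) hPx0
      _ = C' ^ P x * (a + W x) ^ P x := ENNReal.mul_rpow_of_nonneg _ _ hPx0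
      _ ≤ C' ^ P x * (2 ^ P x * (a ^ P x + W x ^ P x)) := by
        gcongr
        exact add_rpow_le_two_rpow_mul _ _ hPx0
      _ ≤ C' ^ pp * (2 ^ pp * (a ^ pp + W x ^ P x)) := by
        gcongr
        · exact le_max_right _ _
        · norm_num
      _ = _ := by rw [hM, mul_assoc]
  have hmod : ∫⁻ x in Ω', (κ⁻¹ * ‖u x‖ₑ) ^ P x ≤ K₀ := by
    calc _ ≤ ∫⁻ x in Ω', M * (a ^ pp + W x ^ P x) := setLIntegral_mono' hΩ'o.measurableSet hpow
      _ = M * (a ^ pp * volume Ω' + ∫⁻ x in Ω', W x ^ P x) := by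
        rw [lintegral_const_mul' _ _ hMt, lintegral_add_left measurable_const, setLIntegral_const]
      _ ≤ K₀ := by
        rw [hK₀]
        gcongr
        exact lintegral_averaged_rpow_le hd0 hP hP1 hgm hg1 hrvol hΩ'o.measurableSet hoscP
  set k' : ℝ≥0∞ := ENNReal.ofReal K with hk'
  have hk'1 : 1 ≤ k' := ENNReal.one_le_ofReal.2 hK1
  have hk'0 : k' ≠ 0 := (one_pos.trans_le hk'1).ne'
  have hk't : k' ≠ ⊤ := ENNReal.ofReal_ne_top
  have hK₀k' : K₀ ≤ k' := (ENNReal.le_ofReal_iff_toReal_le hK₀t hK0.le).2 (le_max_right _ _)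
  calc _ ≤ ∫⁻ x in Ω', k'⁻¹ * (κ⁻¹ * ‖u x‖ₑ) ^ P x := by
        refine setLIntegral_mono' hΩ'o.measurableSet fun x hx => ?_
        have hPx0 : 0 ≤ P x := zero_le_one.trans (hP1 x)
        rw [← hPp x (hΩ'Ω hx), ← ENNReal.ofReal_rpow_of_nonneg (by positivity) hPx0,
          ENNReal.ofReal_div_of_pos (by positivity), ENNReal.ofReal_mul hK0.le, ofReal_norm,
          div_eq_mul_inv, ENNReal.mul_inv (Or.inl hk'0) (Or.inl hk't), mul_comm, mul_assoc,
          ENNReal.mul_rpow_of_nonneg _ _ hPx0]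
        gcongr
        calc k'⁻¹ ^ P x ≤ k'⁻¹ ^ (1 : ℝ) :=
              ENNReal.rpow_le_rpow_of_exponent_ge (ENNReal.inv_le_one.2 hk'1) (hP1 x)
          _ = k'⁻¹ := ENNReal.rpow_one _
    _ = k'⁻¹ * ∫⁻ x in Ω', (κ⁻¹ * ‖u x‖ₑ) ^ P x :=
        lintegral_const_mul' _ _ (ENNReal.inv_ne_top.2 hk'0)
    _ ≤ k'⁻¹ * k' := by
        gcongr
        exact hmod.trans hK₀k'
    _ = 1 := ENNReal.inv_mul_cancel hk'0 hk't

/-- smooth core of Theorem 2.13 of the paper: the local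
embedding `X_D^{p⁻,p(·)}(Ω) ↪ L^{p(·)}(Ω')` for smooth vector fields, for a
continuous exponent `p` with `p⁻ ≥ 2d/(d+2)`. -/
theorem local_embedding_smooth
    (d : ℕ) (hd : 2 ≤ d) (Ω Ω' : Set (Fin d → ℝ))
    (hΩo : IsOpen Ω) (hΩconn : IsConnected Ω) (hΩb : Bornology.IsBounded Ω)
    (hΩ'o : IsOpen Ω') (hΩ'cpt : IsCompact (closure Ω')) (hΩ'sub : closure Ω' ⊆ Ω)
    (p : (Fin d → ℝ) → ℝ) (hpc : ContinuousOn p Ω)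
    (pminus pplus : ℝ) (hpm : 2 * (d : ℝ) / ((d : ℝ) + 2) ≤ pminus)
    (hbounds : ∀ x ∈ Ω, pminus ≤ p x ∧ p x ≤ pplus) :
    ∃ c > 0, ∀ u : (Fin d → ℝ) → (Fin d → ℝ), ContDiffOn ℝ (⊤ : ℕ∞) u Ω →
      (∫⁻ x in Ω, ENNReal.ofReal (‖u x‖ ^ pminus)) < ⊤ →
      (∃ lam > 0,
        (∫⁻ x in Ω, ENNReal.ofReal ((‖symGrad d u x‖ / lam) ^ p x)) ≤ 1) →
      (∃ lam > 0,
        (∫⁻ x in Ω', ENNReal.ofReal ((‖u x‖ / lam) ^ p x)) ≤ 1) ∧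
      luxNorm d Ω' p (fun x => ‖u x‖) ≤
        c * (((∫⁻ x in Ω, ENNReal.ofReal (‖u x‖ ^ pminus)).toReal) ^ (1 / pminus)
          + luxNorm d Ω p (fun x => ‖symGrad d u x‖)) := by
  have hpm1 : 1 ≤ pminus := by
    refine le_trans ?_ hpm
    have : (2 : ℝ) ≤ d := by exact_mod_cast hd
    rw [le_div_iff₀ (by linarith)]
    linarith
  have hpm0 : 0 < pminus := one_pos.trans_le hpm1
  obtain ⟨K, hK0, hK⟩ := exists_modular_bound d hd Ω Ω' hΩo hΩb hΩ'o hΩ'cpt hΩ'sub p hpc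
    pminus pplus hpm1 hbounds
  refine ⟨K, hK0, fun u hu hufin ⟨lam₀, hlam₀, hsym₀⟩ => ?_⟩
  have hu1 : ContDiffOn ℝ 1 u Ω := hu.of_le (by exact_mod_cast le_top)
  set I := ∫⁻ x in Ω, ENNReal.ofReal (‖u x‖ ^ pminus) with hI
  set N : ℝ := I.toReal ^ (1 / pminus) with hN
  have hN0 : 0 ≤ N := by positivity
  have hIn : ∀ n, N ≤ n → I ≤ ENNReal.ofReal (n ^ pminus) := by
    intro n hn
    rw [← ENNReal.ofReal_toReal hufin.ne]
    refine ENNReal.ofReal_le_ofReal ?_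
    calc I.toReal = N ^ pminus := by
          rw [hN, ← Real.rpow_mul ENNReal.toReal_nonneg, one_div_mul_cancel hpm0.ne',
            Real.rpow_one]
      _ ≤ n ^ pminus := by gcongr
  refine ⟨⟨K * (N + 1 + lam₀), by positivity,
    hK u hu1 (N + 1) (by positivity) lam₀ hlam₀ (hIn _ (by linarith)) hsym₀⟩, ?_⟩
  rw [← div_le_iff₀' hK0]
  refine le_of_forall_pos_le_add fun ε hε => ?_
  obtain ⟨lam, ⟨hlam, hsym⟩, hlamε⟩ := Real.lt_sInf_add_pos
    (s := {lam : ℝ | 0 < lam ∧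
      (∫⁻ x in Ω, ENNReal.ofReal ((‖symGrad d u x‖ / lam) ^ p x)) ≤ 1})
    ⟨lam₀, hlam₀, hsym₀⟩ (half_pos hε)
  change lam < luxNorm d Ω p (fun x => ‖symGrad d u x‖) + ε / 2 at hlamε
  rw [div_le_iff₀' hK0]
  calc luxNorm d Ω' p (fun x => ‖u x‖) ≤ K * (N + ε / 2 + lam) := by
        refine csInf_le ⟨0, fun t ht => ht.1.le⟩ ⟨by positivity, ?_⟩
        exact hK u hu1 _ (by positivity) lam hlam (hIn _ (by linarith)) hsym
    _ ≤ _ := mul_le_mul_of_nonneg_left (by linarith) hK0.le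
end

section
/- Let d ≥ 2, let Ω ⊆ ℝ^d be a bounded domain, let p ∈ [1,∞) be a constant exponent, and let E : Ω → ℝ^d be a bounded C^∞ vector field with |E(x)| > 0 for a.e. x ∈ Ω. Let B be an open ball whose closure is contained in Ω, let α ≥ 1 + 2/p, and let r ∈ [1,∞) satisfy r ≤ dp/(d−p) in case p < d (with r < ∞ arbitrary in case p ≥ d, and r = dp/(d−p) allowed when p < d). Then there exists a constant c > 0 such that every u ∈ C^∞(Ω; ℝ^m) with ∫_Ω (|u|^p + |∇u|^p) |E|² dx < ∞ satisfies (∫_B |u|^r |E|^{αr} dx)^{1/r} ≤ c [ ∫_Ω (|u|^p + |∇u|^p) |E|² dx ]^{1/p}. -/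
open MeasureTheory
open scoped ENNReal NNReal Manifold

theorem eLpNorm_restrict_eq_of_norm_eq_zero {X G : Type*} [MeasurableSpace X]
    [NormedAddCommGroup G] {μ : Measure X} {s : Set X} {g : X → G} (hg : ∀ x ∉ s, ‖g x‖ = 0)
    (p : ℝ≥0∞) : eLpNorm g p (μ.restrict s) = eLpNorm g p μ :=
  eLpNorm_restrict_eq_of_support_subset
    (Function.support_subset_iff'.2 fun x hx ↦ norm_eq_zero.1 (hg x hx))

/-- Gagliardo-Nirenberg-Sobolev inequality for functions supported in a compact set,
including exponents `p` above the dimension. -/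
theorem exists_eLpNorm_le_eLpNorm_fderiv {V F : Type*} [NormedAddCommGroup V] [NormedSpace ℝ V]
    [FiniteDimensional ℝ V] [MeasurableSpace V] [BorelSpace V]
    (μ : Measure V) [μ.IsAddHaarMeasure]
    [NormedAddCommGroup F] [NormedSpace ℝ F] [FiniteDimensional ℝ F]
    {s : Set V} (hs : IsCompact s) (hd : 2 ≤ Module.finrank ℝ V) {p r : ℝ≥0} (hp : 1 ≤ p)
    (hr : 1 ≤ r)
    (hrp : p < Module.finrank ℝ V → (p : ℝ)⁻¹ - (Module.finrank ℝ V : ℝ)⁻¹ ≤ (r : ℝ)⁻¹) :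
    ∃ C : ℝ≥0, ∀ w : V → F, ContDiff ℝ 1 w → w.support ⊆ s →
      eLpNorm w r μ ≤ C * eLpNorm (fderiv ℝ w) p μ := by
  set d := Module.finrank ℝ V
  obtain ⟨q, hq1, hqp, hqd, hqr⟩ : ∃ q : ℝ≥0, 1 ≤ q ∧ q ≤ p ∧ q < d ∧
      (q : ℝ)⁻¹ - (d : ℝ)⁻¹ ≤ (r : ℝ)⁻¹ := by
    by_cases h : p < d
    · exact ⟨p, hp, le_rfl, h, hrp h⟩
    · have hrpos : (0 : ℝ) < (r : ℝ)⁻¹ := by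
        have : 0 < r := by positivity
        positivity
      have hd0 : (0 : ℝ≥0) < d := by exact_mod_cast (by omega : 0 < d)
      have hdlt : (d : ℝ≥0)⁻¹ < min 1 ((d : ℝ≥0)⁻¹ + r⁻¹) := by
        refine lt_min ?_ ?_
        · refine inv_lt_one_of_one_lt₀ ?_
          exact_mod_cast (by omega : 1 < d)
        · exact lt_add_of_pos_right _ (by exact_mod_cast hrpos)
      have ht0 : 0 < min 1 ((d : ℝ≥0)⁻¹ + r⁻¹) := lt_of_le_of_lt zero_le hdlt
      have hlt : (min 1 ((d : ℝ≥0)⁻¹ + r⁻¹))⁻¹ < d := inv_lt_of_inv_lt₀ hd0 hdlt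
      refine ⟨(min 1 ((d : ℝ≥0)⁻¹ + r⁻¹))⁻¹, ?_, hlt.le.trans (not_lt.1 h), hlt, ?_⟩
      · exact (one_le_inv₀ ht0).2 (min_le_left _ _)
      · have := min_le_right (1 : ℝ≥0) ((d : ℝ≥0)⁻¹ + r⁻¹)
        rw [← NNReal.coe_le_coe] at this
        push_cast at this ⊢
        rw [inv_inv]
        linarith
  have hμ : μ s ≠ ⊤ := hs.measure_lt_top.ne
  have he : (0 : ℝ) ≤ 1 / q - 1 / p := by
    have : (0 : ℝ) < q := by positivity
    exact sub_nonneg.2 (one_div_le_one_div_of_le this (by exact_mod_cast hqp))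
  refine ⟨eLpNormLESNormFDerivOfLeConst F μ s q r * (μ s).toNNReal ^ (1 / q - 1 / p : ℝ),
    fun w hw hws ↦ ?_⟩
  have hsupp (x : V) (hx : x ∉ s) : ‖fderiv ℝ w x‖ = 0 := by
    rw [fderiv_of_notMem_tsupport ℝ fun h ↦ hx (closure_minimal hws hs.isClosed h), norm_zero]
  have hH : eLpNorm (fderiv ℝ w) q μ ≤
      eLpNorm (fderiv ℝ w) p μ * (μ s) ^ (1 / q - 1 / p : ℝ) := by
    have := eLpNorm_le_eLpNorm_mul_rpow_measure_univ (μ := μ.restrict s) (f := fderiv ℝ w)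
      (p := q) (q := p) (by exact_mod_cast hqp)
      (hw.continuous_fderiv one_ne_zero).aestronglyMeasurable
    simpa [eLpNorm_restrict_eq_of_norm_eq_zero hsupp] using this
  calc eLpNorm w r μ ≤ eLpNormLESNormFDerivOfLeConst F μ s q r * eLpNorm (fderiv ℝ w) q μ :=
        eLpNorm_le_eLpNorm_fderiv_of_le μ hw hws hq1 hqd hqr hs.isBounded
    _ ≤ eLpNormLESNormFDerivOfLeConst F μ s q r *
          (eLpNorm (fderiv ℝ w) p μ * (μ s) ^ (1 / q - 1 / p : ℝ)) := by gcongr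
    _ = _ := by
        rw [ENNReal.coe_mul, ENNReal.coe_rpow_of_nonneg _ he, ENNReal.coe_toNNReal hμ]
        ring

/-- If `f` is continuously differentiable with values in an inner product space, then `‖f‖ ^ α`
can be cut off away from a compact set `K`, such that the resulting function and its derivative
are controlled by `‖f‖ ^ β` for `β ≤ α - 1`. -/
theorem exists_contDiff_cutoff_norm_rpow {V H : Type*} [NormedAddCommGroup V] [NormedSpace ℝ V]
    [FiniteDimensional ℝ V] [NormedAddCommGroup H] [InnerProductSpace ℝ H]
    {Ω K : Set V} (hΩ : IsOpen Ω) (hK : IsCompact K) (hKΩ : K ⊆ Ω)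
    {f : V → H} (hf : ContDiffOn ℝ 1 f Ω) {α β : ℝ} (hα : 1 < α) (hβα : β ≤ α - 1) :
    ∃ (L : Set V) (φ : V → ℝ) (C : ℝ), IsCompact L ∧ L ⊆ Ω ∧ ContDiffOn ℝ 1 φ Ω ∧
      (∀ x ∉ L, φ x = 0) ∧ (∀ x ∈ K, φ x = ‖f x‖ ^ α) ∧ 0 ≤ C ∧
      ∀ x ∈ L, ‖φ x‖ ≤ C * ‖f x‖ ^ β ∧ ‖fderiv ℝ φ x‖ ≤ C * ‖f x‖ ^ β := by
  obtain ⟨L, hL, hKL, hLΩ⟩ := exists_compact_between hK hΩ hKΩ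
  obtain ⟨χ, hχ, hχr, hχs, hχ1⟩ := exists_contMDiff_support_eq_eq_one_iff (n := 1) 𝓘(ℝ, V)
    isOpen_interior hK.isClosed hKL
  replace hχ : ContDiff ℝ 1 χ := hχ.contDiff
  have hn : ContDiffOn ℝ 1 (fun x ↦ ‖f x‖ ^ α) Ω := (contDiff_norm_rpow hα).comp_contDiffOn hf
  obtain ⟨A, hA⟩ := hL.exists_bound_of_continuousOn
    (hχ.continuous_fderiv one_ne_zero).continuousOn
  obtain ⟨B, hB⟩ := hL.exists_bound_of_continuousOn (hf.continuousOn.mono hLΩ)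
  obtain ⟨D, hD⟩ := hL.exists_bound_of_continuousOn
    ((hf.continuousOn_fderiv_of_isOpen hΩ le_rfl).mono hLΩ)
  have hpow {γ : ℝ} (hγ : β ≤ γ) (hγ0 : 0 < γ) {x : V} (hx : x ∈ L) :
      ‖f x‖ ^ γ ≤ |B| ^ (γ - β) * ‖f x‖ ^ β := by
    calc ‖f x‖ ^ γ = ‖f x‖ ^ (γ - β) * ‖f x‖ ^ β := by
          rw [← Real.rpow_add' (norm_nonneg _) (by simpa using hγ0.ne'), sub_add_cancel]
      _ ≤ _ := by
          gcongr
          exact (hB x hx).trans (le_abs_self B)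
  have hχb (x : V) : ‖χ x‖ ≤ 1 := by
    have := hχr (Set.mem_range_self x)
    rw [Real.norm_of_nonneg this.1]
    exact this.2
  refine ⟨L, fun x ↦ χ x * ‖f x‖ ^ α,
    |B| ^ (α - β) + (α * |B| ^ (α - 1 - β) * |D| + |B| ^ (α - β) * |A|), hL, hLΩ,
    hχ.contDiffOn.mul hn, fun x hx ↦ ?_, fun x hx ↦ ?_, by positivity, fun x hx ↦ ⟨?_, ?_⟩⟩
  · have : χ x = 0 := Function.notMem_support.1 fun h ↦ hx (interior_subset (hχs ▸ h))
    simp [this]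
  · simp [(hχ1 x).1 hx]
  · rw [norm_mul, Real.norm_of_nonneg (by positivity : 0 ≤ ‖f x‖ ^ α), add_mul]
    refine (mul_le_of_le_one_left (by positivity) (hχb x)).trans ?_
    refine (hpow (by linarith) (by linarith) hx).trans ?_
    exact le_add_of_nonneg_right (by positivity)
  · have hx' := hΩ.mem_nhds (hLΩ hx)
    have hfd : DifferentiableAt ℝ f x := (hf.contDiffAt hx').differentiableAt one_ne_zero
    have hcomp := (hasFDerivAt_norm_rpow (f x) hα).comp x hfd.hasFDerivAt
    have hnd : ‖fderiv ℝ (fun x ↦ ‖f x‖ ^ α) x‖ ≤ α * ‖f x‖ ^ (α - 1) * ‖fderiv ℝ f x‖ := by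
      have : fderiv ℝ (fun x ↦ ‖f x‖ ^ α) x = _ := hcomp.fderiv
      rw [this, ← fderiv_norm_rpow _ hα, ← norm_fderiv_norm_id_rpow _ hα]
      exact ContinuousLinearMap.opNorm_comp_le _ _
    rw [fderiv_fun_mul (d := fun x ↦ ‖f x‖ ^ α) (hχ.differentiable one_ne_zero x)
      hcomp.differentiableAt]
    calc _ ≤ ‖χ x‖ * ‖fderiv ℝ (fun x ↦ ‖f x‖ ^ α) x‖ + ‖‖f x‖ ^ α‖ * ‖fderiv ℝ χ x‖ :=
          (norm_add_le _ _).trans (by rw [norm_smul, norm_smul])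
      _ ≤ 1 * (α * (|B| ^ (α - 1 - β) * ‖f x‖ ^ β) * |D|) +
          (|B| ^ (α - β) * ‖f x‖ ^ β) * |A| := by
        rw [Real.norm_of_nonneg (by positivity : 0 ≤ ‖f x‖ ^ α)]
        gcongr
        · exact hχb x
        · refine hnd.trans ?_
          gcongr
          · exact hpow hβα (by linarith) hx
          · exact (hD x hx).trans (le_abs_self D)
        · exact hpow (by linarith) (by linarith) hx
        · exact (hA x hx).trans (le_abs_self A)
      _ ≤ _ := by
        have : 0 ≤ |B| ^ (α - β) * ‖f x‖ ^ β := by positivity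
        linarith

/-- Local weighted Sobolev inequality: the weight `‖f‖ ^ α` on the left absorbs the derivative
of the weight, leaving `‖f‖ ^ 2` on the right. -/
theorem exists_weighted_sobolev {V H F : Type*} [NormedAddCommGroup V] [NormedSpace ℝ V]
    [FiniteDimensional ℝ V] [MeasurableSpace V] [BorelSpace V]
    (μ : Measure V) [μ.IsAddHaarMeasure] [NormedAddCommGroup H] [InnerProductSpace ℝ H]
    [NormedAddCommGroup F] [NormedSpace ℝ F] [FiniteDimensional ℝ F]
    {Ω K : Set V} (hΩ : IsOpen Ω) (hK : IsCompact K) (hKΩ : K ⊆ Ω)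
    {f : V → H} (hf : ContDiffOn ℝ 1 f Ω) (hd : 2 ≤ Module.finrank ℝ V) {p r : ℝ≥0} {α : ℝ}
    (hp : 1 ≤ p) (hr : 1 ≤ r) (hα : 1 + 2 / (p : ℝ) ≤ α)
    (hrp : p < Module.finrank ℝ V → (p : ℝ)⁻¹ - (Module.finrank ℝ V : ℝ)⁻¹ ≤ (r : ℝ)⁻¹) :
    ∃ C : ℝ≥0, ∀ u : V → F, ContDiffOn ℝ 1 u Ω →
      (∫⁻ x in K, ENNReal.ofReal (‖u x‖ ^ (r : ℝ) * (‖f x‖ ^ α) ^ (r : ℝ)) ∂μ) ^ (1 / (r : ℝ)) ≤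
        C * (∫⁻ x in Ω, ENNReal.ofReal
          ((‖u x‖ ^ (p : ℝ) + ‖fderiv ℝ u x‖ ^ (p : ℝ)) * ‖f x‖ ^ 2) ∂μ) ^ (1 / (p : ℝ)) := by
  have hp0 : (0 : ℝ) < p := by positivity
  have hr0 : (0 : ℝ) < r := by positivity
  have hβ : 0 < 2 / (p : ℝ) := by positivity
  obtain ⟨L, φ, C, hL, hLΩ, hφ, hφL, hφK, hC, hφC⟩ := exists_contDiff_cutoff_norm_rpow hΩ hK hKΩ hf
    (by linarith : 1 < α) (by linarith : 2 / (p : ℝ) ≤ α - 1)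
  obtain ⟨G, hG⟩ := exists_eLpNorm_le_eLpNorm_fderiv (F := F) μ hL hd hp hr hrp
  lift C to ℝ≥0 using hC
  refine ⟨G * (C ^ (p : ℝ) * 2 ^ (p : ℝ)) ^ (1 / (p : ℝ)), fun u hu ↦ ?_⟩
  set w : V → F := fun x ↦ φ x • u x with hw_def
  have hwL (x : V) (hx : x ∉ L) : w x = 0 := by simp [hw_def, hφL x hx]
  have hw : ContDiff ℝ 1 w := by
    rw [contDiff_iff_contDiffAt]
    intro x
    by_cases hx : x ∈ L
    · exact (hφ.smul hu).contDiffAt (hΩ.mem_nhds (hLΩ hx))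
    · refine contDiffAt_const (c := (0 : F)) |>.congr_of_eventuallyEq ?_
      filter_upwards [hL.isClosed.isOpen_compl.mem_nhds hx] with y hy using hwL y hy
  have hws : w.support ⊆ L := Function.support_subset_iff'.2 hwL
  have hDw (x : V) (hx : x ∉ L) : ‖fderiv ℝ w x‖ = 0 := by
    rw [fderiv_of_notMem_tsupport ℝ fun h ↦ hx (closure_minimal hws hL.isClosed h), norm_zero]
  have hpt (x : V) : ‖fderiv ℝ w x‖ ≤ C * ‖f x‖ ^ (2 / (p : ℝ)) * (‖u x‖ + ‖fderiv ℝ u x‖) := by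
    by_cases hx : x ∈ L
    · have hx' := hΩ.mem_nhds (hLΩ hx)
      have h1 := (hφ.contDiffAt hx').differentiableAt one_ne_zero
      have h2 := (hu.contDiffAt hx').differentiableAt one_ne_zero
      rw [hw_def, fderiv_fun_smul h1 h2]
      calc _ ≤ ‖φ x‖ * ‖fderiv ℝ u x‖ + ‖fderiv ℝ φ x‖ * ‖u x‖ := by
            refine (norm_add_le _ _).trans ?_
            rw [norm_smul, ContinuousLinearMap.norm_smulRight_apply]
        _ ≤ C * ‖f x‖ ^ (2 / (p : ℝ)) * ‖fderiv ℝ u x‖ + C * ‖f x‖ ^ (2 / (p : ℝ)) * ‖u x‖ := by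
            gcongr
            · exact (hφC x hx).1
            · exact (hφC x hx).2
        _ = _ := by ring
    · rw [hDw x hx]
      positivity
  have hptp (x : V) : ‖fderiv ℝ w x‖ₑ ^ (p : ℝ) ≤ ENNReal.ofReal (C ^ (p : ℝ) * 2 ^ (p : ℝ)) *
      ENNReal.ofReal ((‖u x‖ ^ (p : ℝ) + ‖fderiv ℝ u x‖ ^ (p : ℝ)) * ‖f x‖ ^ 2) := by
    rw [← ENNReal.ofReal_mul (by positivity), ← ofReal_norm,
      ENNReal.ofReal_rpow_of_nonneg (norm_nonneg _) hp0.le]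
    apply ENNReal.ofReal_le_ofReal
    have hsum : (‖u x‖ + ‖fderiv ℝ u x‖) ^ (p : ℝ) ≤
        2 ^ (p : ℝ) * (‖u x‖ ^ (p : ℝ) + ‖fderiv ℝ u x‖ ^ (p : ℝ)) := by
      have key {a b : ℝ} (ha : 0 ≤ a) (hab : a ≤ b) :
          (a + b) ^ (p : ℝ) ≤ 2 ^ (p : ℝ) * (a ^ (p : ℝ) + b ^ (p : ℝ)) := by
        have hb := ha.trans hab
        calc (a + b) ^ (p : ℝ) ≤ (2 * b) ^ (p : ℝ) := by gcongr; linarith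
          _ = 2 ^ (p : ℝ) * b ^ (p : ℝ) := Real.mul_rpow (by norm_num) hb
          _ ≤ _ := by
            gcongr
            exact le_add_of_nonneg_left (by positivity)
      rcases le_total ‖u x‖ ‖fderiv ℝ u x‖ with h | h
      · exact key (norm_nonneg _) h
      · rw [add_comm, add_comm (‖u x‖ ^ (p : ℝ))]
        exact key (norm_nonneg _) h
    have hfp : (‖f x‖ ^ (2 / (p : ℝ))) ^ (p : ℝ) = ‖f x‖ ^ 2 := by
      rw [← Real.rpow_mul (norm_nonneg _), div_mul_cancel₀ _ hp0.ne', Real.rpow_two]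
    calc ‖fderiv ℝ w x‖ ^ (p : ℝ)
        ≤ (C * ‖f x‖ ^ (2 / (p : ℝ)) * (‖u x‖ + ‖fderiv ℝ u x‖)) ^ (p : ℝ) := by
          gcongr
          exact hpt x
      _ = C ^ (p : ℝ) * ‖f x‖ ^ 2 * (‖u x‖ + ‖fderiv ℝ u x‖) ^ (p : ℝ) := by
          rw [Real.mul_rpow (by positivity) (by positivity),
            Real.mul_rpow (by positivity) (by positivity), hfp]
      _ ≤ C ^ (p : ℝ) * ‖f x‖ ^ 2 *
            (2 ^ (p : ℝ) * (‖u x‖ ^ (p : ℝ) + ‖fderiv ℝ u x‖ ^ (p : ℝ))) := by gcongr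
      _ = _ := by ring
  have hleft : (∫⁻ x in K, ENNReal.ofReal (‖u x‖ ^ (r : ℝ) * (‖f x‖ ^ α) ^ (r : ℝ)) ∂μ) ^
      (1 / (r : ℝ)) ≤ eLpNorm w r μ := by
    rw [eLpNorm_eq_lintegral_rpow_enorm_toReal (by exact_mod_cast hr0.ne') ENNReal.coe_ne_top,
      ENNReal.coe_toReal]
    refine ENNReal.rpow_le_rpow (le_trans (le_of_eq ?_) (setLIntegral_le_lintegral K _))
      (by positivity)
    refine setLIntegral_congr_fun hK.measurableSet fun x hx ↦ ?_
    have : ‖w x‖ = ‖u x‖ * ‖f x‖ ^ α := by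
      rw [hw_def, norm_smul, hφK x hx, Real.norm_of_nonneg (by positivity), mul_comm]
    rw [← ofReal_norm, ENNReal.ofReal_rpow_of_nonneg (norm_nonneg _) hr0.le, this,
      Real.mul_rpow (by positivity) (by positivity)]
  have hright : eLpNorm (fderiv ℝ w) p μ ≤
      (ENNReal.ofReal (C ^ (p : ℝ) * 2 ^ (p : ℝ)) * ∫⁻ x in Ω, ENNReal.ofReal
        ((‖u x‖ ^ (p : ℝ) + ‖fderiv ℝ u x‖ ^ (p : ℝ)) * ‖f x‖ ^ 2) ∂μ) ^ (1 / (p : ℝ)) := by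
    rw [← eLpNorm_restrict_eq_of_norm_eq_zero fun x hx ↦ hDw x fun h ↦ hx (hLΩ h),
      eLpNorm_eq_lintegral_rpow_enorm_toReal (by exact_mod_cast hp0.ne') ENNReal.coe_ne_top,
      ENNReal.coe_toReal, ← lintegral_const_mul' _ _ ENNReal.ofReal_ne_top]
    gcongr with x
    exact hptp x
  refine hleft.trans ((hG w hw hws).trans ?_)
  rw [ENNReal.coe_mul, mul_assoc]
  gcongr
  refine hright.trans_eq ?_
  rw [ENNReal.mul_rpow_of_nonneg _ _ (by positivity), ENNReal.coe_rpow_of_nonneg _ (by positivity)]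
  congr 2
  rw [← ENNReal.ofReal_coe_nnreal]
  push_cast
  rfl

/-- smooth-function form of Theorem 3.6 of the paper, on
balls: the weighted Sobolev embedding
`X_∇^{p,p}(Ω;|E|²) ↪ L^r(B;|E|^{αr})` for a constant exponent `p`, a ball
`B ⊂⊂ Ω`, `α ≥ 1 + 2/p` and `r ≤ p*` (with `r < ∞` arbitrary if `p ≥ d`).
Here `|E(x)|² = ∑ i, (E x i)²` is the squared Euclidean norm. -/
theorem weighted_sobolev_embedding_smooth
    (d m : ℕ) (hd : 2 ≤ d) (Ω : Set (Fin d → ℝ))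
    (hΩo : IsOpen Ω) (hΩconn : IsConnected Ω) (hΩb : Bornology.IsBounded Ω)
    (E : (Fin d → ℝ) → (Fin d → ℝ)) (hEc : ContDiffOn ℝ (⊤ : ℕ∞) E Ω)
    (M : ℝ) (hEb : ∀ x ∈ Ω, ‖E x‖ ≤ M)
    (hEpos : ∀ᵐ x ∂volume.restrict Ω, 0 < ∑ i, (E x i) ^ 2)
    (p : ℝ) (hp : 1 ≤ p)
    (x₀ : Fin d → ℝ) (R : ℝ) (hR : 0 < R)
    (hball : closure (Metric.ball x₀ R) ⊆ Ω)
    (α : ℝ) (hα : 1 + 2 / p ≤ α)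
    (r : ℝ) (hr1 : 1 ≤ r)
    (hrp : p < (d : ℝ) → r ≤ (d : ℝ) * p / ((d : ℝ) - p)) :
    ∃ c > 0, ∀ u : (Fin d → ℝ) → (Fin m → ℝ), ContDiffOn ℝ (⊤ : ℕ∞) u Ω →
      (∫⁻ x in Ω, ENNReal.ofReal
        ((‖u x‖ ^ p + ‖fderiv ℝ u x‖ ^ p) * ∑ i, (E x i) ^ 2)) < ⊤ →
      (∫⁻ x in Metric.ball x₀ R, ENNReal.ofReal
        (‖u x‖ ^ r * (∑ i, (E x i) ^ 2) ^ (α * r / 2))) < ⊤ ∧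
      ((∫⁻ x in Metric.ball x₀ R, ENNReal.ofReal
          (‖u x‖ ^ r * (∑ i, (E x i) ^ 2) ^ (α * r / 2))).toReal) ^ (1 / r) ≤
        c * ((∫⁻ x in Ω, ENNReal.ofReal
          ((‖u x‖ ^ p + ‖fderiv ℝ u x‖ ^ p) * ∑ i, (E x i) ^ 2)).toReal)
            ^ (1 / p) := by
  have hp0 : 0 < p := by linarith
  have hr0 : 0 < r := by linarith
  have hrp' : p < (d : ℝ) → p⁻¹ - (d : ℝ)⁻¹ ≤ r⁻¹ := fun h ↦ by
    have h0 : 0 < (d : ℝ) - p := sub_pos.2 h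
    have hd0 : (0 : ℝ) < d := hp0.trans h
    calc p⁻¹ - (d : ℝ)⁻¹ = (d * p / (d - p))⁻¹ := by field_simp
      _ ≤ r⁻¹ := inv_anti₀ hr0 (hrp h)
  lift p to ℝ≥0 using hp0.le
  lift r to ℝ≥0 using hr0.le
  let f : (Fin d → ℝ) → EuclideanSpace ℝ (Fin d) := fun x ↦ WithLp.toLp 2 (E x)
  have hf : ContDiffOn ℝ 1 f Ω :=
    PiLp.contDiff_toLp.comp_contDiffOn (hEc.of_le (by exact_mod_cast le_top))
  have hfE (x) : ∑ i, (E x i) ^ 2 = ‖f x‖ ^ 2 := (EuclideanSpace.real_norm_sq_eq (f x)).symm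
  have hfr (x) : (‖f x‖ ^ 2) ^ (α * r / 2) = (‖f x‖ ^ α) ^ (r : ℝ) := by
    rw [← Real.rpow_natCast_mul (norm_nonneg _), ← Real.rpow_mul (norm_nonneg _)]
    congr 1
    push_cast
    ring
  have hK : IsCompact (closure (Metric.ball x₀ R)) := Metric.isBounded_ball.isCompact_closure
  obtain ⟨C, hC⟩ := exists_weighted_sobolev (F := Fin m → ℝ) volume hΩo hK hball hf
    (by simpa using hd) (by exact_mod_cast hp) (by exact_mod_cast hr1) hα
    (fun h ↦ by
      simp only [Module.finrank_fin_fun] at h ⊢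
      exact hrp' (by exact_mod_cast h))
  refine ⟨C + 1, by positivity, fun u hu hfin ↦ ?_⟩
  simp only [hfE, hfr] at hfin ⊢
  have key := (ENNReal.rpow_le_rpow (lintegral_mono_set subset_closure)
    (by positivity : 0 ≤ 1 / (r : ℝ))).trans (hC u (hu.of_le (by exact_mod_cast le_top)))
  have htop := ENNReal.mul_lt_top (ENNReal.coe_lt_top (r := C))
    (ENNReal.rpow_lt_top_of_nonneg (by positivity : 0 ≤ 1 / (p : ℝ)) hfin.ne)
  refine ⟨?_, ?_⟩
  · exact (ENNReal.rpow_lt_top_iff_of_pos (by positivity)).1 (key.trans_lt htop)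
  · have := ENNReal.toReal_mono htop.ne key
    rw [ENNReal.toReal_mul, ← ENNReal.toReal_rpow, ← ENNReal.toReal_rpow,
      ENNReal.coe_toReal] at this
    refine this.trans ?_
    gcongr
    linarith
end
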